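/- arXiv:2507.05862 — 2 statements merged into one kernel-verified Lean document; each statement's English description precedes it below -/
import Mathlib

section
/- Let f be a prime with 2×10^20 ≤ f ≤ 4×10^49, let χ be a Dirichlet character modulo f of order 3, and let q₁ < q₂ be the two smallest prime cubic non-residues modulo f (assumed to exist). If q₁ ≥ 293, then q₁ ≤ q₂ ≤ 37·f^{0.232}. -/
section PartA
open Polynomial

noncomputable def stOp {F : Type*} [Field F] (g : F[X]) (c : F) : ℕ → (F[X] →ₗ[F] F[X])
  | 0 => LinearMap.id
  | l + 1 => (LinearMap.mulLeft F g) ∘ₗ (derivative) ∘ₗ (stOp g c l)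
      + (LinearMap.mulLeft F (C (c - l) * derivative g)) ∘ₗ (stOp g c l)

lemma stOp_succ {F : Type*} [Field F] (g : F[X]) (c : F) (l : ℕ) (k : F[X]) :
    stOp g c (l+1) k = g * derivative (stOp g c l k) + C (c - l) * derivative g * stOp g c l k := by
  simp [stOp]; ring

lemma stOp_spec {F : Type*} [Field F] (g : F[X]) (n l : ℕ) (k : F[X]) :
    g ^ l * (derivative^[l] (k * g ^ n)) = g ^ n * stOp g (n : F) l k := by
  induction l with
  | zero => simp [stOp, mul_comm]
  | succ l ih =>
    have h := congrArg (fun q => g * derivative q) ih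
    simp only [derivative_mul, derivative_pow] at h
    rw [Function.iterate_succ_apply', stOp_succ]
    set Q := derivative^[l] (k * g ^ n)
    set R := stOp g (n : F) l k
    have e1 : g * (C (l : F) * g ^ (l - 1) * derivative g * Q) = C (l : F) * derivative g * (g ^ l * Q) := by
      cases l with
      | zero => simp
      | succ l => simp only [Nat.add_sub_cancel]; ring
    have e2 : g * (C (n : F) * g ^ (n - 1) * derivative g * R) = C (n : F) * derivative g * (g ^ n * R) := by
      cases n with
      | zero => simp
      | succ l => simp only [Nat.add_sub_cancel]; ring
    rw [mul_add, mul_add, e1, e2, ih] at h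
    have e3 : C ((n : F) - l) = C (n : F) - C (l : F) := by simp
    rw [e3]
    linear_combination h

lemma stOp_deg {F : Type*} [Field F] (g : F[X]) (hg : g.natDegree ≤ 4) (c : F) (K : ℕ) (k : F[X])
    (hk : k.natDegree ≤ K) (l : ℕ) : (stOp g c l k).natDegree ≤ K + 3 * l := by
  induction l with
  | zero => simpa [stOp] using hk
  | succ l ih =>
    rw [stOp_succ]
    have hg' : (derivative g).natDegree ≤ 3 := (natDegree_derivative_le g).trans (by omega)
    refine natDegree_add_le_of_degree_le ?_ ?_
    · by_cases h0 : (stOp g c l k).natDegree = 0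
      · rw [natDegree_eq_zero] at h0
        obtain ⟨a, ha⟩ := h0
        rw [← ha]; simp
      · refine natDegree_mul_le.trans ?_
        have := natDegree_derivative_le (stOp g c l k)
        omega
    · refine natDegree_mul_le.trans ?_
      have : (C (c - l) * derivative g).natDegree ≤ 3 := (natDegree_C_mul_le _ _).trans hg'
      omega

lemma st_deriv_Xp {p : ℕ} [Fact p.Prime] (q : (ZMod p)[X]) (i l : ℕ) :
    derivative^[l] (q * X ^ (i * p)) = derivative^[l] q * X ^ (i * p) := by
  induction l with
  | zero => simp
  | succ l ih =>
    rw [Function.iterate_succ_apply', ih, Function.iterate_succ_apply', derivative_mul]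
    simp [derivative_X_pow]

lemma st_inj (k i j a i' j' a' : ℕ) (ha : a + 1 < k) (ha' : a' + 1 < k) (hj : j < 3) (hj' : j' < 3)
    (h : a + 4 * (j * k) + i * (3 * k + 1) = a' + 4 * (j' * k) + i' * (3 * k + 1)) :
    i = i' ∧ j = j' := by
  have key : ∀ d : ℕ, ∀ a j a' j' : ℕ, a + 1 < k → a' + 1 < k → j < 3 → j' < 3 →
      a + 4 * (j * k) + d * (3 * k + 1) = a' + 4 * (j' * k) → d = 0 ∧ j = j' := by
    intro d a j a' j' ha ha' hj hj' h
    have hd : d < 4 := by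
      by_contra hd
      push Not at hd
      have : 4 * (3 * k + 1) ≤ d * (3 * k + 1) := Nat.mul_le_mul_right _ hd
      have : j' * k ≤ 2 * k := Nat.mul_le_mul_right _ (by omega)
      omega
    interval_cases d <;> interval_cases j <;> interval_cases j' <;> omega
  rcases le_total i' i with hi | hi
  · obtain ⟨d, rfl⟩ := Nat.exists_eq_add_of_le hi
    have := key d a j a' j' ha ha' hj hj' (by rw [add_mul] at h; omega)
    omega
  · obtain ⟨d, rfl⟩ := Nat.exists_eq_add_of_le hi
    have := key d a' j' a j ha' ha hj' hj (by rw [add_mul] at h; omega)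
    omega

noncomputable def stTp (F : Type*) [Field F] (K : ℕ) : (Fin K → F) →ₗ[F] F[X] :=
  (degreeLT F K).subtype ∘ₗ ((degreeLTEquiv F K).symm : (Fin K → F) →ₗ[F] degreeLT F K)

lemma stTp_ne {F : Type*} [Field F] {K : ℕ} {c : Fin K → F} (hc : c ≠ 0) : stTp F K c ≠ 0 := by
  intro h
  apply hc
  have : Function.Injective (stTp F K) := by
    unfold stTp
    rw [LinearMap.coe_comp]
    exact (Submodule.subtype_injective _).comp (degreeLTEquiv F K).symm.injective
  exact this (by simpa using h)

lemma stTp_deg {F : Type*} [Field F] {K : ℕ} (c : Fin K → F) : (stTp F K c).degree < K := by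
  have := ((degreeLTEquiv F K).symm c).2
  rw [mem_degreeLT] at this
  exact this

noncomputable def stP {F : Type*} [Field F] (g : F[X]) (k K I l : ℕ) :
    (Fin I × Fin 3 → Fin K → F) →ₗ[F] F[X] :=
  ∑ ij : Fin I × Fin 3, (LinearMap.mulLeft F (X ^ (ij.1 : ℕ))) ∘ₗ
    (stOp g (((ij.2 : ℕ) * k : ℕ) : F) l) ∘ₗ (stTp F K) ∘ₗ (LinearMap.proj ij)

lemma stP_apply {F : Type*} [Field F] (g : F[X]) (k K I l : ℕ) (c : Fin I × Fin 3 → Fin K → F) :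
    stP g k K I l c = ∑ ij : Fin I × Fin 3, X ^ (ij.1 : ℕ) *
      stOp g (((ij.2 : ℕ) * k : ℕ) : F) l (stTp F K (c ij)) := by
  simp [stP]

lemma stP_deg {F : Type*} [Field F] (g : F[X]) (hg : g.natDegree ≤ 4) (k K I l : ℕ) (hK : 1 ≤ K)
    (c : Fin I × Fin 3 → Fin K → F) : (stP g k K I l c).natDegree ≤ (I - 1) + (K - 1 + 3 * l) := by
  rw [stP_apply]
  refine natDegree_sum_le_of_forall_le _ _ fun ij _ => ?_
  refine natDegree_mul_le.trans ?_
  rw [natDegree_X_pow]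
  have h1 : (stTp F K (c ij)).natDegree ≤ K - 1 := by
    have := stTp_deg (c ij)
    by_cases h0 : stTp F K (c ij) = 0
    · simp [h0]
    · have := (natDegree_lt_iff_degree_lt h0).2 this
      omega
  have := stOp_deg g hg (((ij.2 : ℕ) * k : ℕ) : F) (K - 1) _ h1 l
  have := ij.1.2
  omega

lemma st_exists {F : Type*} [Field F] (g : F[X]) (hg : g.natDegree ≤ 4) (k s : ℕ) (hs : 1 ≤ s)
    (hsk : 11 * s ^ 2 ≤ 4 * (k - 1)) :
    ∃ c : Fin (s + 2) × Fin 3 → Fin (k - 1) → F, c ≠ 0 ∧ ∀ l < 3 * s, stP g k (k - 1) (s + 2) l c = 0 := by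
  classical
  have hK : 1 ≤ k - 1 := by
    have : 1 ≤ s ^ 2 := Nat.one_le_pow _ _ hs
    omega
  let L : (Fin (s + 2) × Fin 3 → Fin (k - 1) → F) →ₗ[F]
      ((Σ l : Fin (3 * s), Fin ((k - 1) + 3 * (l : ℕ) + s + 1)) → F) :=
    LinearMap.pi fun σ => (lcoeff F (σ.2 : ℕ)) ∘ₗ (stP g k (k - 1) (s + 2) (σ.1 : ℕ))
  have hker : LinearMap.ker L ≠ ⊥ := by
    apply LinearMap.ker_ne_bot_of_finrank_lt
    rw [Module.finrank_pi, Module.finrank_pi_fintype]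
    simp only [Module.finrank_pi, Fintype.card_sigma, Fintype.card_fin, Finset.sum_const,
      Finset.card_univ, Fintype.card_prod, smul_eq_mul]
    rw [Fin.sum_univ_eq_sum_range (fun l => (k - 1) + 3 * l + s + 1)]
    have h1 : ∀ M : ℕ, (∑ l ∈ Finset.range M, ((k - 1) + 3 * l + s + 1)) * 2 + 3 * M
        = 2 * M * (k - 1 + s + 1) + 3 * M * M := by
      intro M
      induction M with
      | zero => simp
      | succ M ih => rw [Finset.sum_range_succ]; linarith
    have := h1 (3 * s)
    generalize k - 1 = K at *
    nlinarith
  obtain ⟨c, hc, hc0⟩ := (Submodule.ne_bot_iff _).1 hker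
  refine ⟨c, hc0, fun l hl => ?_⟩
  have hL : L c = 0 := hc
  ext r
  rw [coeff_zero]
  by_cases hr : r < (k - 1) + 3 * l + s + 1
  · exact congrFun hL ⟨⟨l, hl⟩, ⟨r, hr⟩⟩
  · apply coeff_eq_zero_of_natDegree_lt
    have := stP_deg g hg k (k - 1) (s + 2) l hK c
    omega

lemma stepanov (p k s : ℕ) [hpp : Fact p.Prime] (hp : p = 3 * k + 1) (g : (ZMod p)[X])
    (hd : g.natDegree = 4) (hs : 1 ≤ s) (hsk : 11 * s ^ 2 ≤ 4 * (k - 1)) :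
    (Finset.univ.filter fun x : ZMod p => (g.eval x) ^ k = 1).card * (3 * s) ≤ (s + 1) * p + 9 * k := by
  classical
  obtain ⟨c, hc0, hc⟩ := st_exists g hd.le k s hs hsk
  have hk : 3 ≤ k ∧ s ≤ k := by
    have : 1 ≤ s ^ 2 := Nat.one_le_pow _ _ hs
    have : s ≤ s ^ 2 := Nat.le_self_pow (by norm_num) s
    omega
  have hg0 : g ≠ 0 := by rintro rfl; simp at hd
  let t : Fin (s + 2) × Fin 3 → (ZMod p)[X] := fun ij =>
    stTp (ZMod p) (k - 1) (c ij) * g ^ ((ij.2 : ℕ) * k) * X ^ ((ij.1 : ℕ) * p)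
  let T : (ZMod p)[X] := ∑ ij, t ij
  have htd : ∀ ij, t ij ≠ 0 → ∃ a, a + 1 < k ∧
      (t ij).degree = ((a + 4 * ((ij.2 : ℕ) * k) + (ij.1 : ℕ) * (3 * k + 1) : ℕ) : WithBot ℕ) := by
    intro ij hij
    have h0 : stTp (ZMod p) (k - 1) (c ij) ≠ 0 := by
      intro h; apply hij; simp [t, h]
    refine ⟨(stTp (ZMod p) (k - 1) (c ij)).natDegree, ?_, ?_⟩
    · have := (natDegree_lt_iff_degree_lt h0).2 (stTp_deg (c ij))
      omega
    · rw [degree_eq_natDegree hij]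
      congr 1
      simp only [t]
      rw [natDegree_mul (mul_ne_zero h0 (pow_ne_zero _ hg0)) (pow_ne_zero _ X_ne_zero),
        natDegree_mul h0 (pow_ne_zero _ hg0), natDegree_pow, natDegree_X_pow, hd, ← hp]
      ring
  have hTdeg : T.degree = Finset.univ.sup fun ij => (t ij).degree := by
    apply degree_sum_eq_of_disjoint
    rintro u ⟨-, hu⟩ v ⟨-, hv⟩ huv heq
    obtain ⟨a, ha, hau⟩ := htd u hu
    obtain ⟨b, hb, hbv⟩ := htd v hv
    simp only [Function.comp] at heq
    rw [hau, hbv] at heq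
    have heq' := WithBot.coe_injective heq
    have := st_inj k _ _ _ _ _ _ ha hb u.2.2 v.2.2 heq'
    exact huv (Prod.ext (Fin.ext this.1) (Fin.ext this.2))
  have hT0 : T ≠ 0 := by
    obtain ⟨ij, hij⟩ : ∃ ij, c ij ≠ 0 := by
      by_contra h; push Not at h; exact hc0 (funext h)
    have ht : t ij ≠ 0 :=
      mul_ne_zero (mul_ne_zero (stTp_ne hij) (pow_ne_zero _ hg0)) (pow_ne_zero _ X_ne_zero)
    intro h
    rw [h, degree_zero] at hTdeg
    have : (t ij).degree ≤ ⊥ := hTdeg ▸ Finset.le_sup (f := fun ij => (t ij).degree) (Finset.mem_univ ij)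
    exact ht (degree_eq_bot.1 (le_bot_iff.1 this))
  have hTd : T.natDegree ≤ (s + 1) * p + 9 * k := by
    apply natDegree_sum_le_of_forall_le
    intro ij _
    by_cases h0 : t ij = 0
    · simp [h0]
    obtain ⟨a, ha, hau⟩ := htd ij h0
    rw [natDegree_eq_of_degree_eq_some hau]
    have h1 : (ij.2 : ℕ) * k ≤ 2 * k := Nat.mul_le_mul_right _ (by have := ij.2.2; omega)
    have h2 : (ij.1 : ℕ) * (3 * k + 1) ≤ (s + 1) * p := by
      rw [hp]; exact Nat.mul_le_mul_right _ (by have := ij.1.2; omega)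
    omega
  have hroot : ∀ x : ZMod p, (g.eval x) ^ k = 1 → 3 * s ≤ T.rootMultiplicity x := by
    intro x hx
    have hgx : g.eval x ≠ 0 := by
      intro h; rw [h, zero_pow (by omega)] at hx; exact zero_ne_one hx
    have := lt_rootMultiplicity_of_isRoot_iterate_derivative_of_mem_nonZeroDivisors (p := T) (t := x)
      (n := 3 * s - 1) hT0 ?_ ?_
    · omega
    · intro l hl
      have h1 : g ^ l * derivative^[l] T = ∑ ij : Fin (s + 2) × Fin 3,
          g ^ ((ij.2 : ℕ) * k) * stOp g (((ij.2 : ℕ) * k : ℕ) : ZMod p) l (stTp _ (k - 1) (c ij)) *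
            X ^ ((ij.1 : ℕ) * p) := by
        simp only [T, t, iterate_derivative_sum, Finset.mul_sum]
        refine Finset.sum_congr rfl fun ij _ => ?_
        rw [st_deriv_Xp, ← mul_assoc, stOp_spec]
      have h2 := congrArg (eval x) h1
      have h3 := congrArg (eval x) (hc l (by omega))
      rw [stP_apply, eval_finsetSum] at h3
      rw [eval_mul, eval_finsetSum, eval_pow] at h2
      have h4 : ∀ ij : Fin (s + 2) × Fin 3, eval x (g ^ ((ij.2 : ℕ) * k) *
          stOp g (((ij.2 : ℕ) * k : ℕ) : ZMod p) l (stTp _ (k - 1) (c ij)) * X ^ ((ij.1 : ℕ) * p))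
          = eval x (X ^ (ij.1 : ℕ) * stOp g (((ij.2 : ℕ) * k : ℕ) : ZMod p) l (stTp _ (k - 1) (c ij))) := by
        intro ij
        simp only [eval_mul, eval_pow, eval_X]
        rw [mul_comm (ij.2 : ℕ) k, pow_mul, hx, one_pow, one_mul, pow_mul, ZMod.pow_card, mul_comm]
      simp only [h4] at h2
      rw [h3, eval_zero] at h2
      exact (mul_eq_zero.1 h2).resolve_left (pow_ne_zero _ hgx)
    · rw [mem_nonZeroDivisors_iff_ne_zero, Ne, ZMod.natCast_eq_zero_iff, hpp.out.dvd_factorial]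
      omega
  calc _ = ∑ x ∈ Finset.univ.filter (fun x : ZMod p => (g.eval x) ^ k = 1), 3 * s := by simp
    _ ≤ ∑ x ∈ Finset.univ.filter (fun x : ZMod p => (g.eval x) ^ k = 1), T.roots.count x := by
        refine Finset.sum_le_sum fun x hx => ?_
        rw [count_roots]
        exact hroot x (Finset.mem_filter.1 hx).2
    _ ≤ T.roots.card := by
        rw [← Multiset.toFinset_sum_count_eq T.roots]
        calc _ ≤ ∑ x ∈ Finset.univ, T.roots.count x := Finset.sum_le_sum_of_subset (Finset.subset_univ _)
          _ = _ := by
            symm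
            apply Finset.sum_subset (Finset.subset_univ _)
            intro x _ hx
            rw [Multiset.mem_toFinset] at hx
            exact Multiset.count_eq_zero.2 hx
    _ ≤ T.natDegree := card_roots' T
    _ ≤ _ := hTd
end PartA

section PartB
open Polynomial

lemma chi_at_zero {p : ℕ} [Fact p.Prime] (χ : DirichletCharacter ℂ p) : χ 0 = 0 :=
  MulChar.map_zero χ

lemma chi_cube {p : ℕ} [Fact p.Prime] (χ : DirichletCharacter ℂ p) (hχ : orderOf χ = 3)
    {x : ZMod p} (hx : x ≠ 0) : χ x ^ 3 = 1 := by
  have h : χ ^ 3 = 1 := by rw [← hχ]; exact pow_orderOf_eq_one χ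
  have h2 := DFunLike.congr_fun h x
  rw [MulChar.pow_apply' _ (by norm_num)] at h2
  rw [h2, MulChar.one_apply (isUnit_iff_ne_zero.2 hx)]

lemma chi_mod3 {p : ℕ} [Fact p.Prime] (χ : DirichletCharacter ℂ p) (hχ : orderOf χ = 3) :
    ∃ k, p = 3 * k + 1 := by
  have h := MulChar.orderOf_dvd_card_sub_one (F := ZMod p) (χ := χ)
  rw [hχ, ZMod.card] at h
  obtain ⟨k, hk⟩ := h
  have := (Fact.out : p.Prime).two_le
  exact ⟨k, by omega⟩

lemma chi_one_pow {p k : ℕ} [Fact p.Prime] (hp : p = 3 * k + 1) (χ : DirichletCharacter ℂ p)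
    (hχ : orderOf χ = 3) {x : ZMod p} (hx : χ x = 1) : x ^ k = 1 := by
  have hx0 : x ≠ 0 := by
    rintro rfl
    rw [MulChar.map_zero] at hx
    exact zero_ne_one hx
  obtain ⟨γ, hγ⟩ := IsCyclic.exists_generator (α := (ZMod p)ˣ)
  have hγ1 : χ γ ≠ 1 := by
    intro h
    have : χ = 1 := by
      ext a
      obtain ⟨n, hn⟩ := (mem_powers_iff_mem_zpowers.2 (hγ a) : a ∈ Submonoid.powers γ)
      simp only at hn
      rw [← hn, Units.val_pow_eq_pow_val, map_pow, h, one_pow, ← Units.val_pow_eq_pow_val,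
        MulChar.one_apply_coe]
    rw [this, orderOf_one] at hχ
    norm_num at hχ
  have hord : orderOf (χ γ) = 3 := by
    refine orderOf_eq_prime (chi_cube χ hχ γ.ne_zero) hγ1
  obtain ⟨e, he⟩ := (mem_powers_iff_mem_zpowers.2 (hγ (Units.mk0 x hx0)) : _ ∈ Submonoid.powers γ)
  simp only at he
  have hxe : x = (γ : ZMod p) ^ e := by
    rw [← Units.val_pow_eq_pow_val, he]; rfl
  rw [hxe, map_pow] at hx
  have h3 : 3 ∣ e := by rw [← hord]; exact orderOf_dvd_of_pow_eq_one hx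
  obtain ⟨d, rfl⟩ := h3
  rw [hxe, ← pow_mul, show 3 * d * k = (p - 1) * d by rw [hp]; simp; ring, pow_mul,
    ZMod.pow_card_sub_one_eq_one γ.ne_zero, one_pow]

noncomputable def c4 {p : ℕ} (χ : DirichletCharacter ℂ p) (a b c d x : ZMod p) : ℂ :=
  χ (x + a) * χ (x + b) * (starRingEnd ℂ) (χ (x + c) * χ (x + d))

lemma chi_conj {p : ℕ} [Fact p.Prime] (χ : DirichletCharacter ℂ p) (hχ : orderOf χ = 3)
    (x : ZMod p) : (starRingEnd ℂ) (χ x) = χ x ^ 2 := by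
  by_cases hx : x = 0
  · subst hx; simp [chi_at_zero]
  have h := chi_cube χ hχ hx
  have hn : ‖χ x‖ = 1 := Complex.norm_eq_one_of_pow_eq_one h (by norm_num)
  have h2 : χ x * (starRingEnd ℂ) (χ x) = 1 := by
    rw [Complex.mul_conj, Complex.normSq_eq_norm_sq, hn]; simp
  have h0 : χ x ≠ 0 := left_ne_zero_of_mul_eq_one h2
  apply mul_left_cancel₀ h0
  rw [h2, ← h]; ring

lemma chi_eq_zero {p : ℕ} [Fact p.Prime] (χ : DirichletCharacter ℂ p) {x : ZMod p} (h : χ x ≠ 0) :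
    x ≠ 0 := by
  rintro rfl; exact h (chi_at_zero χ)

lemma c4_count {p k s : ℕ} [hpp : Fact p.Prime] (hp : p = 3 * k + 1) (χ : DirichletCharacter ℂ p)
    (hχ : orderOf χ = 3) (hs : 1 ≤ s) (hsk : 11 * s ^ 2 ≤ 4 * (k - 1))
    (a b c d : ZMod p) (hda : d ≠ a) (hdb : d ≠ b) :
    (Finset.univ.filter fun x : ZMod p => c4 χ a b c d x = 1).card * (3 * s) ≤ (s + 1) * p + 9 * k := by
  classical
  have lin : ∀ u : ZMod p, u ≠ 0 → (1 + C u * X : (ZMod p)[X]).natDegree = 1 := by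
    intro u hu
    rw [show (1 + C u * X : (ZMod p)[X]) = C u * X + C 1 by simp [add_comm]]
    exact natDegree_linear hu
  have lin0 : ∀ u : ZMod p, u ≠ 0 → (1 + C u * X : (ZMod p)[X]) ≠ 0 := by
    intro u hu h
    have := lin u hu
    rw [h] at this; simp at this
  have ha : a - d ≠ 0 := sub_ne_zero.2 hda.symm
  have hb : b - d ≠ 0 := sub_ne_zero.2 hdb.symm
  obtain ⟨g, hg4, hg⟩ : ∃ g : (ZMod p)[X], g.natDegree = 4 ∧ ∀ x : ZMod p, c4 χ a b c d x = 1 →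
      χ (g.eval (x + d)⁻¹) = 1 := by
    by_cases hc : c = d
    · subst hc
      refine ⟨((1 + C (a - c) * X) * (1 + C (b - c) * X)) ^ 2, ?_, ?_⟩
      · rw [natDegree_pow, natDegree_mul (lin0 _ ha) (lin0 _ hb), lin _ ha, lin _ hb]
      · intro x hx
        have hxc : x + c ≠ 0 := by
          intro h; simp [c4, h, chi_at_zero] at hx
        have e : eval (x + c)⁻¹ (((1 + C (a - c) * X) * (1 + C (b - c) * X)) ^ 2) =
            ((x + a) * (x + b) * ((x + c)⁻¹) ^ 2) ^ 2 := by
          simp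
          field_simp
          ring
        have hinv : χ ((x + c)⁻¹) = (starRingEnd ℂ) (χ (x + c)) := by
          have h1 : χ (x + c) * χ ((x + c)⁻¹) = 1 := by
            rw [← map_mul, mul_inv_cancel₀ hxc, map_one]
          have h3 := chi_cube χ hχ hxc
          rw [chi_conj χ hχ]
          linear_combination (-χ (x + c)⁻¹) * h3 + (χ (x+c))^2 * h1
        rw [e]
        simp only [map_mul, map_pow, hinv]
        simp only [c4, map_mul] at hx
        rw [pow_two ((starRingEnd ℂ) (χ (x + c))), hx, one_pow]
    · have hc' : c - d ≠ 0 := sub_ne_zero.2 hc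
      refine ⟨(1 + C (a - d) * X) * (1 + C (b - d) * X) * (1 + C (c - d) * X) ^ 2, ?_, ?_⟩
      · rw [natDegree_mul (mul_ne_zero (lin0 _ ha) (lin0 _ hb)) (pow_ne_zero _ (lin0 _ hc')),
          natDegree_pow, natDegree_mul (lin0 _ ha) (lin0 _ hb), lin _ ha, lin _ hb, lin _ hc']
      · intro x hx
        have hxd : x + d ≠ 0 := by
          intro h; simp [c4, h, chi_at_zero] at hx
        have e : eval (x + d)⁻¹ ((1 + C (a - d) * X) * (1 + C (b - d) * X) * (1 + C (c - d) * X) ^ 2) =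
            (x + a) * (x + b) * (x + c) ^ 2 * ((x + d)⁻¹) ^ 4 := by
          simp
          field_simp
          ring
        have hinv : χ ((x + d)⁻¹) ^ 4 = (starRingEnd ℂ) (χ (x + d)) := by
          have h1 : χ (x + d) * χ ((x + d)⁻¹) = 1 := by
            rw [← map_mul, mul_inv_cancel₀ hxd, map_one]
          have h3 := chi_cube χ hχ hxd
          have h4 := chi_cube χ hχ (inv_ne_zero hxd)
          rw [chi_conj χ hχ]
          linear_combination (-χ (x + d)⁻¹) * h3 + (χ (x+d))^2 * h1 + χ (x + d)⁻¹ * h4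
        rw [e]
        simp only [map_mul, map_pow, hinv]
        simp only [c4, map_mul] at hx
        rw [← chi_conj χ hχ, mul_assoc, hx]
  refine le_trans (Nat.mul_le_mul_right _ ?_) (stepanov p k s hp g hg4 hs hsk)
  apply Finset.card_le_card_of_injOn (fun x => (x + d)⁻¹)
  · intro x hx
    simp only [Finset.coe_filter, Finset.mem_univ, true_and, Set.mem_ofPred_eq] at hx ⊢
    exact chi_one_pow hp χ hχ (hg x hx)
  · intro x _ y _ hxy
    simpa using hxy

lemma re_cube_root {z : ℂ} (hz : z ^ 3 = 1) (h1 : z ≠ 1) : z.re = -1/2 := by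
  have hn : ‖z‖ = 1 := Complex.norm_eq_one_of_pow_eq_one hz (by norm_num)
  have h2 : z ^ 2 + z + 1 = 0 := by
    have : (z - 1) * (z ^ 2 + z + 1) = 0 := by linear_combination hz
    exact (mul_eq_zero.1 this).resolve_left (sub_ne_zero.2 h1)
  have h3 : z.re ^ 2 + z.im ^ 2 = 1 := by
    have := Complex.normSq_eq_norm_sq z
    rw [hn, Complex.normSq_apply] at this
    nlinarith
  have h4 := congrArg Complex.re h2
  simp [pow_two] at h4
  have h5 := congrArg Complex.im h2
  simp [pow_two] at h5
  have h6 : z.im * (2 * z.re + 1) = 0 := by linarith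
  rcases mul_eq_zero.1 h6 with h | h
  · rw [h] at h4
    nlinarith [sq_nonneg (z.re + 1/2)]
  · linarith

lemma c4_sum {p k s : ℕ} [hpp : Fact p.Prime] (hp : p = 3 * k + 1) (χ : DirichletCharacter ℂ p)
    (hχ : orderOf χ = 3) (hs : 1 ≤ s) (hsk : 11 * s ^ 2 ≤ 4 * (k - 1))
    (a b c d : ZMod p) (hda : d ≠ a) (hdb : d ≠ b) :
    ∑ x, (c4 χ a b c d x).re ≤ 2 * p / s + 2 := by
  classical
  have hcount := c4_count hp χ hχ hs hsk a b c d hda hdb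
  set n0 := (Finset.univ.filter fun x : ZMod p => c4 χ a b c d x = 1).card with hn0
  have hpt : ∀ x, (c4 χ a b c d x).re ≤ (3/2) * (if c4 χ a b c d x = 1 then 1 else 0) - 1/2 +
      ((if x = -a then 1/2 else 0) + (if x = -b then 1/2 else 0) + (if x = -c then 1/2 else 0)
        + (if x = -d then (1/2:ℝ) else 0)) := by
    intro x
    have hnn : ∀ u, (0:ℝ) ≤ (if x = -u then (1/2:ℝ) else 0) := by intro u; split_ifs <;> norm_num
    by_cases h1 : c4 χ a b c d x = 1
    · rw [h1]; simp only [Complex.one_re, if_true]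
      linarith [hnn a, hnn b, hnn c, hnn d]
    · rw [if_neg h1]
      by_cases h0 : x = -a ∨ x = -b ∨ x = -c ∨ x = -d
      · have hz : c4 χ a b c d x = 0 := by
          rcases h0 with h | h | h | h <;> simp [c4, h, chi_at_zero]
        rw [hz]
        have : (1/2:ℝ) ≤ ((if x = -a then 1/2 else 0) + (if x = -b then 1/2 else 0) + (if x = -c then 1/2 else 0)
        + (if x = -d then (1/2:ℝ) else 0)) := by
          rcases h0 with h | h | h | h
          · have : (if x = -a then (1/2:ℝ) else 0) = 1/2 := if_pos h
            linarith [hnn a, hnn b, hnn c, hnn d]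
          · have : (if x = -b then (1/2:ℝ) else 0) = 1/2 := if_pos h
            linarith [hnn a, hnn b, hnn c, hnn d]
          · have : (if x = -c then (1/2:ℝ) else 0) = 1/2 := if_pos h
            linarith [hnn a, hnn b, hnn c, hnn d]
          · have : (if x = -d then (1/2:ℝ) else 0) = 1/2 := if_pos h
            linarith [hnn a, hnn b, hnn c, hnn d]
        simp only [Complex.zero_re]
        linarith
      · push Not at h0
        obtain ⟨ha, hb, hc, hd⟩ := h0
        have hne : ∀ u : ZMod p, x ≠ -u → x + u ≠ 0 := fun u hu h => hu (eq_neg_of_add_eq_zero_left h)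
        have hz : c4 χ a b c d x ^ 3 = 1 := by
          have e : c4 χ a b c d x ^ 3 = χ (x + a) ^ 3 * χ (x + b) ^ 3 *
              ((starRingEnd ℂ) (χ (x + c) ^ 3) * (starRingEnd ℂ) (χ (x + d) ^ 3)) := by
            simp only [c4, map_mul, map_pow (starRingEnd ℂ)]; ring
          rw [e, chi_cube χ hχ (hne a ha), chi_cube χ hχ (hne b hb), chi_cube χ hχ (hne c hc),
            chi_cube χ hχ (hne d hd)]
          simp
        rw [re_cube_root hz h1]
        linarith [hnn a, hnn b, hnn c, hnn d]
  have hsum := Finset.sum_le_sum (fun x (_ : x ∈ Finset.univ) => hpt x)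
  simp only [Finset.sum_add_distrib, Finset.sum_sub_distrib, ← Finset.mul_sum, Finset.sum_ite_eq',
    Finset.mem_univ, if_true, Finset.sum_const, Finset.card_univ, ZMod.card, nsmul_eq_mul,
    Finset.sum_boole] at hsum
  rw [← hn0] at hsum
  have hs' : (0:ℝ) < s := by exact_mod_cast hs
  have hcount' : (n0:ℝ) * (3 * s) ≤ (s + 1) * p + 9 * k := by exact_mod_cast hcount
  have hpk : (p:ℝ) = 3 * k + 1 := by exact_mod_cast hp
  refine hsum.trans ?_
  have : (3/2 : ℝ) * n0 - p/2 ≤ 2 * p / s := by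
    rw [le_div_iff₀ hs']
    nlinarith
  linarith
end PartB

section PartC

noncomputable def Asum {p : ℕ} (χ : DirichletCharacter ℂ p) (h : ℕ) (x : ZMod p) : ℂ :=
  ∑ j ∈ Finset.range h, χ (x + (j : ZMod p))

lemma chi_norm_le {p : ℕ} [Fact p.Prime] (χ : DirichletCharacter ℂ p) (x : ZMod p) : ‖χ x‖ ≤ 1 :=
  DirichletCharacter.norm_le_one χ x

lemma c4_re_le {p : ℕ} [Fact p.Prime] (χ : DirichletCharacter ℂ p) (a b c d x : ZMod p) :
    (c4 χ a b c d x).re ≤ 1 := by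
  refine (Complex.re_le_norm _).trans ?_
  simp only [c4, norm_mul, RCLike.norm_conj]
  have h1 := chi_norm_le χ (x + a)
  have h2 := chi_norm_le χ (x + b)
  have h3 := chi_norm_le χ (x + c)
  have h4 := chi_norm_le χ (x + d)
  have := mul_le_one₀ (mul_le_one₀ h1 (norm_nonneg _) h2) (by positivity) 
    (mul_le_one₀ h3 (norm_nonneg _) h4)
  exact this

lemma c4_re_sum_le {p : ℕ} [Fact p.Prime] (χ : DirichletCharacter ℂ p) (a b c d : ZMod p) :
    ∑ x, (c4 χ a b c d x).re ≤ p := by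
  calc ∑ x, (c4 χ a b c d x).re ≤ ∑ x : ZMod p, (1 : ℝ) :=
        Finset.sum_le_sum fun x _ => c4_re_le χ a b c d x
    _ = p := by simp [ZMod.card]

lemma c4_swap {p : ℕ} (χ : DirichletCharacter ℂ p) (a b c d x : ZMod p) :
    c4 χ a b c d x = c4 χ a b d c x := by
  simp only [c4]; rw [mul_comm (χ (x + c))]

lemma c4_conj {p : ℕ} (χ : DirichletCharacter ℂ p) (a b c d x : ZMod p) :
    (c4 χ a b c d x).re = (c4 χ c d a b x).re := by
  rw [← Complex.conj_re]
  congr 1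
  simp only [c4, map_mul, Complex.conj_conj]; ring

lemma c4_sum_off {p k s : ℕ} [hpp : Fact p.Prime] (hp : p = 3 * k + 1)
    (χ : DirichletCharacter ℂ p)
    (hχ : orderOf χ = 3) (hs : 1 ≤ s) (hsk : 11 * s ^ 2 ≤ 4 * (k - 1))
    (a b c d : ZMod p) (h : ¬ ((a = c ∧ b = d) ∨ (a = d ∧ b = c))) :
    ∑ x, (c4 χ a b c d x).re ≤ 2 * p / s + 2 := by
  by_cases h1 : d ≠ a ∧ d ≠ b
  · exact c4_sum hp χ hχ hs hsk a b c d h1.1 h1.2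
  by_cases h2 : c ≠ a ∧ c ≠ b
  · simp_rw [c4_swap χ a b c d]
    exact c4_sum hp χ hχ hs hsk a b d c h2.1 h2.2
  by_cases h3 : b ≠ c ∧ b ≠ d
  · simp_rw [c4_conj χ a b c d]
    exact c4_sum hp χ hχ hs hsk c d a b h3.1 h3.2
  by_cases h4 : a ≠ c ∧ a ≠ d
  · simp_rw [c4_conj χ a b c d, c4_swap χ c d a b]
    exact c4_sum hp χ hχ hs hsk c d b a h4.1 h4.2
  exfalso
  grind

lemma sum_quad (s : Finset ℕ) (u v : ℕ → ℂ) :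
    (∑ a ∈ s, u a) * (∑ b ∈ s, u b) * ((∑ c ∈ s, v c) * (∑ d ∈ s, v d)) =
    ∑ a ∈ s, ∑ b ∈ s, ∑ c ∈ s, ∑ d ∈ s, u a * u b * (v c * v d) := by
  rw [Finset.sum_mul_sum, Finset.sum_mul_sum, Finset.sum_mul]
  refine Finset.sum_congr rfl fun a _ => ?_
  rw [Finset.sum_mul]
  refine Finset.sum_congr rfl fun b _ => ?_
  rw [Finset.mul_sum]
  refine Finset.sum_congr rfl fun c _ => ?_
  rw [Finset.mul_sum]

lemma fourth_moment {p k s h : ℕ} [hpp : Fact p.Prime] (hp : p = 3 * k + 1)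
    (χ : DirichletCharacter ℂ p)
    (hχ : orderOf χ = 3) (hs : 1 ≤ s) (hsk : 11 * s ^ 2 ≤ 4 * (k - 1)) (hh : h ≤ p) :
    ∑ x, ‖Asum χ h x‖ ^ 4 ≤ 2 * (h:ℝ) ^ 2 * p + (h : ℝ) ^ 4 * (2 * p / s + 2) := by
  classical
  have inj : ∀ i ∈ Finset.range h, ∀ j ∈ Finset.range h, (i : ZMod p) = j → i = j := by
    intro i hi j hj e
    rw [ZMod.natCast_eq_natCast_iff] at e
    exact Nat.ModEq.eq_of_lt_of_lt e (by simp at hi; omega) (by simp at hj; omega)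
  have e1 : ∀ x, ‖Asum χ h x‖ ^ 4 = ∑ a ∈ Finset.range h, ∑ b ∈ Finset.range h,
      ∑ c ∈ Finset.range h, ∑ d ∈ Finset.range h, (c4 χ a b c d x).re := by
    intro x
    have : ((‖Asum χ h x‖ ^ 4 : ℝ) : ℂ) = Asum χ h x * Asum χ h x *
        ((starRingEnd ℂ) (Asum χ h x) * (starRingEnd ℂ) (Asum χ h x)) := by
      have := Complex.mul_conj' (Asum χ h x)
      push_cast
      calc _ = ((‖Asum χ h x‖ : ℂ) ^ 2) ^ 2 := by ring
        _ = _ := by rw [← this]; ring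
    rw [← Complex.ofReal_re (‖Asum χ h x‖ ^ 4), this]
    simp only [Asum, map_sum]
    rw [sum_quad]
    simp only [Complex.re_sum, c4, map_mul]
  have e2 : ∑ x, ‖Asum χ h x‖ ^ 4 = ∑ a ∈ Finset.range h, ∑ b ∈ Finset.range h,
      ∑ c ∈ Finset.range h, ∑ d ∈ Finset.range h, ∑ x, (c4 χ a b c d x).re := by
    rw [Finset.sum_congr rfl fun x _ => e1 x, Finset.sum_comm]
    refine Finset.sum_congr rfl fun a _ => ?_
    rw [Finset.sum_comm]
    refine Finset.sum_congr rfl fun b _ => ?_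
    rw [Finset.sum_comm]
    refine Finset.sum_congr rfl fun c _ => ?_
    rw [Finset.sum_comm]
  have hW : (0:ℝ) ≤ 2 * p / s + 2 := by positivity
  have e3 : ∀ a ∈ Finset.range h, ∀ b ∈ Finset.range h, ∀ c ∈ Finset.range h,
      ∀ d ∈ Finset.range h, ∑ x, (c4 χ a b c d x).re ≤
      (2 * p / s + 2) + ((if a = c then (if b = d then (p:ℝ) else 0) else 0) +
        (if a = d then (if b = c then (p:ℝ) else 0) else 0)) := by
    intro a ha b hb c hc d hd
    by_cases H : ((a = c ∧ b = d) ∨ (a = d ∧ b = c))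
    · have := c4_re_sum_le χ (a : ZMod p) b c d
      have hp0 : (0:ℝ) ≤ p := by positivity
      rcases H with ⟨h1, h2⟩ | ⟨h1, h2⟩
      · rw [if_pos h1, if_pos h2]
        split_ifs <;> linarith
      · rw [if_pos h1, if_pos h2]
        split_ifs <;> linarith
    · have := c4_sum_off hp χ hχ hs hsk (a : ZMod p) b c d (by
        rintro (⟨h1, h2⟩ | ⟨h1, h2⟩)
        · exact H (Or.inl ⟨inj _ ha _ hc h1, inj _ hb _ hd h2⟩)
        · exact H (Or.inr ⟨inj _ ha _ hd h1, inj _ hb _ hc h2⟩))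
      refine this.trans (le_add_of_nonneg_right ?_)
      split_ifs <;> positivity
  rw [e2]
  refine (Finset.sum_le_sum fun a ha => Finset.sum_le_sum fun b hb => Finset.sum_le_sum
    fun c hc => Finset.sum_le_sum fun d hd => e3 a ha b hb c hc d hd).trans ?_
  simp only [Finset.sum_add_distrib]
  have d1 : ∑ a ∈ Finset.range h, ∑ b ∈ Finset.range h, ∑ c ∈ Finset.range h,
      ∑ d ∈ Finset.range h, (if a = c then (if b = d then (p:ℝ) else 0) else 0) = h ^ 2 * p := by
    calc _ = ∑ a ∈ Finset.range h, ∑ b ∈ Finset.range h, (p : ℝ) := by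
          refine Finset.sum_congr rfl fun a ha => Finset.sum_congr rfl fun b hb => ?_
          rw [Finset.sum_eq_single a]
          · rw [Finset.sum_eq_single b]
            · simp
            · intro d _ hd; simp [hd.symm]
            · intro h; exact absurd hb h
          · intro c _ hc; simp [hc.symm]
          · intro h; exact absurd ha h
      _ = _ := by simp; ring
  have d2 : ∑ a ∈ Finset.range h, ∑ b ∈ Finset.range h, ∑ c ∈ Finset.range h,
      ∑ d ∈ Finset.range h, (if a = d then (if b = c then (p:ℝ) else 0) else 0) = h ^ 2 * p := by
    calc _ = ∑ a ∈ Finset.range h, ∑ b ∈ Finset.range h, (p : ℝ) := by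
          refine Finset.sum_congr rfl fun a ha => Finset.sum_congr rfl fun b hb => ?_
          rw [Finset.sum_eq_single b]
          · rw [Finset.sum_eq_single a]
            · simp
            · intro d _ hd; simp [hd.symm]
            · intro h; exact absurd ha h
          · intro c _ hc; simp [hc.symm]
          · intro h; exact absurd hb h
      _ = _ := by simp; ring
  rw [d1, d2]
  simp
  apply le_of_eq; ring
end PartC

section PartD

/-- The lattice window. -/
noncomputable def Wq (p h N : ℕ) (q : ℕ) : Finset (ℤ × ℤ) :=
  ((Finset.Ico (1:ℤ) q) ×ˢ (Finset.Icc (0:ℤ) p)).filter fun w =>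
    -(N:ℤ) ≤ q * w.2 - w.1 * p ∧ q * (w.2 + h - 1) - w.1 * p ≤ N

noncomputable def Nset (h N q j : ℕ) : Finset ℤ :=
  (Finset.Icc (-((N:ℤ) - q * j)) ((N:ℤ) - q * (h - 1 - j))).filter fun n => ¬ ((q:ℤ) ∣ n)

lemma mem_Wq {p h N q : ℕ} {w : ℤ × ℤ} : w ∈ Wq p h N q ↔ ((1 ≤ w.1 ∧ w.1 < q) ∧ 0 ≤ w.2 ∧ w.2 ≤ p) ∧
    -(N:ℤ) ≤ q * w.2 - w.1 * p ∧ q * (w.2 + h - 1) - w.1 * p ≤ N := by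
  simp [Wq]

lemma mem_Nset {h N q j : ℕ} {n : ℤ} : n ∈ Nset h N q j ↔
    (-((N:ℤ) - q * j) ≤ n ∧ n ≤ (N:ℤ) - q * (h - 1 - j)) ∧ ¬ ((q:ℤ) ∣ n) := by
  simp [Nset]

lemma lattice_bij {p h N q j : ℕ} (hp : p.Prime) (hq : q.Prime) (hqp : q < p) (hN : N < p)
    (hj : j < h) (F : ℤ → ℝ) :
    ∑ w ∈ Wq p h N q, F (q * (w.2 + j) - w.1 * p) = ∑ n ∈ Nset h N q j, F n := by
  have hq0 : (0:ℤ) < q := by exact_mod_cast hq.pos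
  have hcop : ¬ ((q:ℤ) ∣ p) := by
    intro h; have := (Nat.prime_dvd_prime_iff_eq hq hp).1 (by exact_mod_cast h); omega
  have hqP : Prime (q:ℤ) := Nat.prime_iff_prime_int.1 hq
  have key : ∀ t : ℤ, 1 ≤ t → t < q → ¬ (q:ℤ) ∣ t := by
    intro t h1 h2 h3
    have := Int.le_of_dvd (by omega) h3
    omega
  refine Finset.sum_bij (fun w _ => q * (w.2 + j) - w.1 * p) ?_ ?_ ?_ ?_
  · rintro ⟨t, x⟩ hw
    rw [mem_Wq] at hw
    obtain ⟨⟨⟨h1, h2⟩, h3, h4⟩, h5, h6⟩ := hw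
    simp only at *
    rw [mem_Nset]
    refine ⟨⟨by linarith, by linarith⟩, ?_⟩
    intro hd
    have : (q:ℤ) ∣ t * p := by
      have h7 : (q:ℤ) ∣ q * (x + j) := dvd_mul_right _ _
      have := dvd_sub h7 hd
      simpa using this
    rcases hqP.dvd_or_dvd this with h | h
    · exact key t h1 h2 h
    · exact hcop h
  · rintro ⟨t, x⟩ hw ⟨t', x'⟩ hw' e
    rw [mem_Wq] at hw hw'
    obtain ⟨⟨⟨h1, h2⟩, -, -⟩, -, -⟩ := hw
    obtain ⟨⟨⟨h1', h2'⟩, -, -⟩, -, -⟩ := hw'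
    simp only at *
    have hd : (q:ℤ) ∣ (t - t') * p := ⟨x - x', by linarith⟩
    have ht : t = t' := by
      rcases hqP.dvd_or_dvd hd with h | h
      · have := Int.eq_zero_of_abs_lt_dvd h (by rw [abs_lt]; constructor <;> linarith)
        omega
      · exact absurd h hcop
    subst ht
    have : x = x' := by
      have : (q:ℤ) * x = q * x' := by linarith
      exact mul_left_cancel₀ hq0.ne' this
    rw [this]
  · intro n hn
    rw [mem_Nset] at hn
    obtain ⟨⟨h1, h2⟩, h3⟩ := hn
    haveI : Fact q.Prime := ⟨hq⟩
    have hpq : ((p:ℕ) : ZMod q) ≠ 0 := by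
      intro h; rw [ZMod.natCast_eq_zero_iff] at h; exact hcop (by exact_mod_cast h)
    have hnq : ((n:ℤ) : ZMod q) ≠ 0 := by
      intro h; rw [ZMod.intCast_zmod_eq_zero_iff_dvd] at h; exact h3 (by exact_mod_cast h)
    set u : ZMod q := -(n : ZMod q) * (p : ZMod q)⁻¹ with hu
    have hu0 : u ≠ 0 := mul_ne_zero (neg_ne_zero.2 hnq) (inv_ne_zero hpq)
    have hdv : (q:ℤ) ∣ n + (u.val : ℤ) * p := by
      rw [← ZMod.intCast_zmod_eq_zero_iff_dvd]
      push_cast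
      rw [ZMod.natCast_val, ZMod.cast_id, hu]
      field_simp; ring
    obtain ⟨y, hy⟩ := hdv
    have hv1 : 1 ≤ u.val := Nat.one_le_iff_ne_zero.2 (by simpa [ZMod.val_eq_zero] using hu0)
    have hv2 : u.val < q := ZMod.val_lt u
    have hv1' : (1:ℤ) ≤ u.val := by exact_mod_cast hv1
    have hv2' : (u.val:ℤ) + 1 ≤ q := by exact_mod_cast hv2
    have hpN : (N:ℤ) < p := by exact_mod_cast hN
    have hj' : (j:ℤ) + 1 ≤ h := by exact_mod_cast hj
    refine ⟨((u.val:ℤ), y - j), ?_, ?_⟩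
    · rw [mem_Wq]
      simp only
      have e1 : (q:ℤ) * (y - j) - u.val * p = n - q * j := by linarith
      have e2 : (q:ℤ) * (y - j + h - 1) - u.val * p = n + q * (h - 1 - j) := by linarith
      refine ⟨⟨⟨hv1', by omega⟩, ?_, ?_⟩, by rw [e1]; linarith, by rw [e2]; linarith⟩
      · by_contra hc
        push Not at hc
        have : (q:ℤ) * (y - j) < 0 := mul_neg_of_pos_of_neg hq0 hc
        nlinarith
      · by_contra hc
        push Not at hc
        have h7 : (q:ℤ) * (y - j) ≥ q * (p + 1) := mul_le_mul_of_nonneg_left (by omega) hq0.le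
        have h8 : (0:ℤ) ≤ q * (h - 1) := mul_nonneg hq0.le (by omega)
        nlinarith
    · simp only; linarith
  · intros; rfl

lemma Nset_card {h N q j : ℕ} (hq : 0 < q) (hab : (0:ℤ) ≤ 2 * N - q * (h - 1)) :
    (2 * (N:ℝ) - q * (h - 1)) * (1 - 1 / q) - 1 ≤ ((Nset h N q j).card : ℝ) := by
  have hq0 : (0:ℤ) < q := by exact_mod_cast hq
  set a : ℤ := -((N:ℤ) - q * j) with ha
  set b : ℤ := (N:ℤ) - q * (h - 1 - j) with hb
  have hI : Finset.Icc a b = Finset.Ioc (a - 1) b := by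
    ext x; simp
  have h1 : ((Finset.Ioc (a-1) b).filter fun n => (q:ℤ) ∣ n).card + (Nset h N q j).card =
      (Finset.Ioc (a-1) b).card := by
    rw [Nset, ← ha, ← hb, hI]
    exact Finset.card_filter_add_card_filter_not _
  have h2 := Int.Ioc_filter_dvd_card (a-1) b (r := q) hq0
  have hba : b - a = 2 * N - q * (h - 1) := by rw [ha, hb]; ring
  rw [Int.card_Ioc] at h1
  have h3 : ((b - (a-1)).toNat : ℤ) = b - a + 1 := by rw [Int.toNat_of_nonneg (by omega)]; ring
  have h4 : (((Finset.Ioc (a-1) b).filter fun n => (q:ℤ) ∣ n).card : ℝ) ≤ ((b - a + 1 : ℤ):ℝ) / q + 1 := by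
    have h2' : ((((Finset.Ioc (a-1) b).filter fun n => (q:ℤ) ∣ n).card : ℤ) : ℝ) = _ := congrArg _ h2
    rw [Int.cast_natCast] at h2'
    rw [h2']
    have hpos : (0:ℝ) ≤ ((b - a + 1 : ℤ):ℝ) / q + 1 := by
      have : (0:ℤ) ≤ b - a + 1 := by omega
      have : (0:ℝ) ≤ ((b - a + 1 : ℤ):ℝ) := by exact_mod_cast this
      positivity
    rw [Int.cast_max]
    refine max_le ?_ (by simpa using hpos)
    push_cast
    have f1 := Int.floor_le ((b:ℚ) / (q:ℚ))
    have f2 := Int.lt_floor_add_one (((a - 1:ℤ):ℚ) / (q:ℚ))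
    have : ((⌊(b:ℚ) / (q:ℚ)⌋ : ℚ)) - ⌊((a - 1:ℤ):ℚ) / (q:ℚ)⌋ ≤ (b - a + 1) / q + 1 := by
      push_cast at *
      have : ((b:ℚ) - a + 1) / q = b / q - (a - 1) / q := by ring
      linarith
    have : (((⌊(b:ℚ) / (q:ℚ)⌋ : ℚ) - ⌊((a - 1:ℤ):ℚ) / (q:ℚ)⌋ : ℚ) : ℝ) ≤ (((b - a + 1) / q + 1 : ℚ) : ℝ) := by
      exact_mod_cast this
    push_cast at this
    exact this
  have h5 : (((Finset.Ioc (a-1) b).filter fun n => (q:ℤ) ∣ n).card : ℝ) + (Nset h N q j).card =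
      ((b - a + 1 : ℤ):ℝ) := by
    rw [← h3, ← h1]; push_cast; ring
  have h6 : ((b - a + 1 : ℤ):ℝ) = 2 * N - q * (h-1) + 1 := by rw [hba]; push_cast; ring
  rw [h6] at h4 h5
  have h7 : (0:ℝ) ≤ 1 - 1 / q := by
    rw [sub_nonneg, div_le_one (by exact_mod_cast hq)]; exact_mod_cast hq
  have : (2 * (N:ℝ) - q * (h-1) + 1) / q = (2 * (N:ℝ) - q * (h-1) + 1) * (1 / q) := by ring
  rw [this] at h4
  nlinarith
end PartD

section PartE

open Classical in
noncomputable def badCount {p : ℕ} (χ : DirichletCharacter ℂ p) (y : ℕ) : ℕ :=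
  ((Finset.Icc 1 y).filter fun n : ℕ => χ (n : ZMod p) ≠ 1).card

lemma chi_neg_one {p : ℕ} [Fact p.Prime] (χ : DirichletCharacter ℂ p) (hχ : orderOf χ = 3) :
    χ (-1) = 1 := by
  have h1 := chi_cube χ hχ (x := -1) (by simp)
  have h2 : χ (-1) ^ 2 = 1 := by rw [← map_pow]; simp
  calc χ (-1) = χ (-1) ^ 3 := by rw [pow_succ, h2, one_mul]
    _ = 1 := h1

lemma chi_abs {p : ℕ} [Fact p.Prime] (χ : DirichletCharacter ℂ p) (hχ : orderOf χ = 3) (n : ℤ) :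
    χ (n : ZMod p) = χ ((n.natAbs : ℕ) : ZMod p) := by
  rcases Int.natAbs_eq n with h | h
  · conv_lhs => rw [h]
    simp
  · conv_lhs => rw [h]
    rw [Int.cast_neg, ← neg_one_mul, map_mul, chi_neg_one χ hχ]
    simp

lemma chi_re_ge {p : ℕ} [Fact p.Prime] (χ : DirichletCharacter ℂ p) (hχ : orderOf χ = 3)
    (x : ZMod p) : -1/2 ≤ (χ x).re := by
  by_cases hx : x = 0
  · subst hx; rw [chi_at_zero]; norm_num
  by_cases h1 : χ x = 1
  · rw [h1]; norm_num
  rw [re_cube_root (chi_cube χ hχ hx) h1]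

open Classical in
lemma Nset_bad {p : ℕ} [Fact p.Prime] (χ : DirichletCharacter ℂ p) (hχ : orderOf χ = 3)
    {h N q j : ℕ} (hj : j < h) (hN : q * h ≤ N) :
    ((Nset h N q j).filter fun n : ℤ => χ (n : ZMod p) ≠ 1).card ≤
      badCount χ (N - q * j) + badCount χ (N - q * (h - 1 - j)) := by
  have : ((Nset h N q j).filter fun n : ℤ => χ (n : ZMod p) ≠ 1) ⊆
     ((Finset.Icc 1 (N - q * j)).filter fun n : ℕ => χ (n : ZMod p) ≠ 1).image (fun n : ℕ => -(n:ℤ)) ∪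
     ((Finset.Icc 1 (N - q * (h-1-j))).filter fun n : ℕ => χ (n : ZMod p) ≠ 1).image
      (fun n : ℕ => (n:ℤ)) := by
    intro n hn
    rw [Finset.mem_filter, mem_Nset, chi_abs χ hχ] at hn
    obtain ⟨⟨⟨h1, h2⟩, h3⟩, h4⟩ := hn
    have h0 : n ≠ 0 := by rintro rfl; simp at h3
    have hm1 : q * j ≤ N := (Nat.mul_le_mul_left q hj.le).trans hN
    have hm2 : q * (h - 1 - j) ≤ N := (Nat.mul_le_mul_left q (by omega)).trans hN
    have e2 : (q:ℤ) * (h - 1 - j) = ((q * (h - 1 - j) : ℕ) : ℤ) := by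
      rw [Nat.cast_mul, Nat.cast_sub (by omega), Nat.cast_sub (by omega)]; simp
    have e1 : (q:ℤ) * j = ((q * j : ℕ) : ℤ) := by simp
    rw [e2] at h2
    rw [e1] at h1
    simp only [Finset.mem_union, Finset.mem_image, Finset.mem_filter, Finset.mem_Icc]
    rcases lt_or_gt_of_ne h0 with h | h
    · left
      exact ⟨n.natAbs, ⟨⟨by omega, by omega⟩, h4⟩, by omega⟩
    · right
      exact ⟨n.natAbs, ⟨⟨by omega, by omega⟩, h4⟩, by omega⟩
  refine (Finset.card_le_card this).trans ((Finset.card_union_le _ _).trans ?_)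
  exact Nat.add_le_add Finset.card_image_le Finset.card_image_le

lemma Nset_sum {p : ℕ} [Fact p.Prime] (χ : DirichletCharacter ℂ p) (hχ : orderOf χ = 3)
    {h N q j : ℕ} (hj : j < h) (hN : 4 * (q * h) ≤ 3 * N) (hq : 300 < q) (hN' : 10 ^ 6 ≤ N) {β m : ℝ}
    (hbad : ∀ y : ℕ, N ≤ 4 * y → y ≤ N → (badCount χ y : ℝ) ≤ β * y)
    (hm : m ≤ 1 - 1.5 * (β / 0.996)) :
    m * (Nset h N q j).card ≤ ∑ n ∈ Nset h N q j, (χ (n : ZMod p)).re := by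
  classical
  have hβ : 0 ≤ β := by
    have := hbad N (by omega) le_rfl
    have h2 : (0:ℝ) ≤ badCount χ N := by positivity
    have h3 : (0:ℝ) < N := by exact_mod_cast (by omega)
    by_contra hc
    push Not at hc
    nlinarith
  have hm1 : q * j ≤ q * h := (Nat.mul_le_mul_left q hj.le)
  have hm2 : q * (h - 1 - j) ≤ q * h := (Nat.mul_le_mul_left q (by omega))
  have b1 := hbad (N - q * j) (by omega) (by omega)
  have b2 := hbad (N - q * (h - 1 - j)) (by omega) (by omega)
  have b3 := Nset_bad χ hχ (h := h) (N := N) (q := q) (j := j) hj (by omega)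
  have b3' : (((Nset h N q j).filter fun n : ℤ => χ (n : ZMod p) ≠ 1).card : ℝ) ≤
      badCount χ (N - q * j) + badCount χ (N - q * (h - 1 - j)) := by exact_mod_cast b3
  have e : ((N - q * j : ℕ) : ℝ) + ((N - q * (h - 1 - j) : ℕ) : ℝ) = 2 * N - q * (h - 1) := by
    rw [Nat.cast_sub (by omega), Nat.cast_sub (by omega)]
    push_cast
    rw [Nat.cast_sub (by omega), Nat.cast_sub (by omega)]
    push_cast; ring
  have hqh : (4 * (q * h) : ℝ) ≤ 3 * N := by exact_mod_cast hN
  have hqR : (300:ℝ) < q := by exact_mod_cast hq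
  have hNR : (10 ^ 6:ℝ) ≤ N := by exact_mod_cast hN'
  have hc := Nset_card (h := h) (N := N) (q := q) (j := j) (by omega) (by
    have : (4 * (q * h) : ℤ) ≤ 3 * N := by exact_mod_cast hN
    nlinarith)
  have hc2 : 0.996 * (2 * (N:ℝ) - q * (h - 1)) ≤ (Nset h N q j).card := by
    have hq1 : 1 / (q:ℝ) ≤ 1 / 300 := one_div_le_one_div_of_le (by norm_num) hqR.le
    have : 1.25 * (N:ℝ) ≤ 2 * (N:ℝ) - q * (h - 1) := by nlinarith
    nlinarith
  have hs : ∑ n ∈ Nset h N q j, (1 - 1.5 * (if χ (n : ZMod p) ≠ 1 then (1:ℝ) else 0)) ≤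
      ∑ n ∈ Nset h N q j, (χ (n : ZMod p)).re := by
    refine Finset.sum_le_sum fun n _ => ?_
    split_ifs with h1
    · have := chi_re_ge χ hχ (n : ZMod p); linarith
    · push Not at h1; rw [h1]; simp
  refine le_trans ?_ hs
  rw [Finset.sum_sub_distrib, ← Finset.mul_sum, Finset.sum_boole]
  simp only [Finset.sum_const, nsmul_eq_mul, mul_one]
  set c : ℝ := ((Nset h N q j).card : ℝ)
  have hc0 : 0 ≤ c := by positivity
  have : m * c ≤ (1 - 1.5 * (β / 0.996)) * c := mul_le_mul_of_nonneg_right hm hc0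
  have h8 : β * (2 * (N:ℝ) - q * (h - 1)) ≤ (β / 0.996) * c := by
    rw [div_mul_eq_mul_div, le_div_iff₀ (by norm_num)]
    nlinarith
  have h9 : β * ((N - q * j : ℕ) : ℝ) + β * ((N - q * (h - 1 - j) : ℕ) : ℝ) = 
     β * (2 * (N:ℝ) - q * (h - 1)) := by rw [← e]; ring
  linarith

/-- The bound for one prime. -/
lemma window_sum {p : ℕ} [hp : Fact p.Prime] (χ : DirichletCharacter ℂ p) (hχ : orderOf χ = 3)
    {h N q : ℕ} (hqp : q.Prime) (hqp' : q < p) (hNp : N < p)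
    (hN : 4 * (q * h) ≤ 3 * N) (hq : 300 < q) (hN' : 10 ^ 6 ≤ N) {β m : ℝ}
    (hbad : ∀ y : ℕ, N ≤ 4 * y → y ≤ N → (badCount χ y : ℝ) ≤ β * y)
    (hm : m ≤ 1 - 1.5 * (β / 0.996)) :
    m * h * (Wq p h N q).card ≤ ∑ w ∈ Wq p h N q, ‖Asum χ h (w.2 : ZMod p)‖ := by
  have h1 : ∑ j ∈ Finset.range h, ∑ w ∈ Wq p h N q, (χ ((q * (w.2 + j) - w.1 * p : ℤ) : ZMod p)).re ≤
      ∑ w ∈ Wq p h N q, ‖Asum χ h (w.2 : ZMod p)‖ := by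
    rw [Finset.sum_comm]
    refine Finset.sum_le_sum fun w _ => ?_
    rw [← Complex.re_sum]
    refine (Complex.re_le_norm _).trans ?_
    have : ∑ j ∈ Finset.range h, χ ((q * (w.2 + j) - w.1 * p : ℤ) : ZMod p) =
        χ (q : ZMod p) * Asum χ h (w.2 : ZMod p) := by
      rw [Asum, Finset.mul_sum]
      refine Finset.sum_congr rfl fun j _ => ?_
      rw [← map_mul]; congr 1; simp
    rw [this, norm_mul]
    exact mul_le_of_le_one_left (norm_nonneg _) (chi_norm_le χ _)
  refine le_trans ?_ h1
  have h2 : ∀ j ∈ Finset.range h, m * (Wq p h N q).card ≤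
      ∑ w ∈ Wq p h N q, (χ ((q * (w.2 + j) - w.1 * p : ℤ) : ZMod p)).re := by
    intro j hj
    have hj' := Finset.mem_range.1 hj
    rw [lattice_bij hp.out hqp hqp' hNp hj' (fun n => (χ (n : ZMod p)).re)]
    have := lattice_bij hp.out hqp hqp' hNp hj' (fun n => (1:ℝ))
    simp only [Finset.sum_const, nsmul_eq_mul, mul_one] at this
    rw [this]
    exact Nset_sum χ hχ hj' hN hq hN' hbad hm
  have h3 := Finset.sum_le_sum h2
  simp only [Finset.sum_const, nsmul_eq_mul, Finset.card_range] at h3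
  linarith

lemma window_card {p : ℕ} [hp : Fact p.Prime] 
    {h N q : ℕ} (hqp : q.Prime) (hqp' : q < p) (hNp : N < p) (hh : 1 ≤ h)
    (hN : 4 * (q * h) ≤ 3 * N) (hq : 300 < q) (hN' : 10 ^ 6 ≤ N) :
    1.245 * (N:ℝ) ≤ (Wq p h N q).card := by
  have := lattice_bij hp.out hqp hqp' hNp (show 0 < h by omega) (fun n => (1:ℝ))
  simp only [Finset.sum_const, nsmul_eq_mul, mul_one] at this
  rw [this]
  have hqh : (4 * (q * h) : ℝ) ≤ 3 * N := by exact_mod_cast hN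
  have hqR : (300:ℝ) < q := by exact_mod_cast hq
  have hNR : (10 ^ 6:ℝ) ≤ N := by exact_mod_cast hN'
  have hc := Nset_card (h := h) (N := N) (q := q) (j := 0) (by omega) (by
    have : (4 * (q * h) : ℤ) ≤ 3 * N := by exact_mod_cast hN
    nlinarith)
  have hq1 : 1 / (q:ℝ) ≤ 1 / 300 := one_div_le_one_div_of_le (by norm_num) hqR.le
  have : 1.25 * (N:ℝ) ≤ 2 * (N:ℝ) - q * (h - 1) := by nlinarith
  nlinarith

lemma window_aux {q t x h N p : ℤ} (hq : 0 < q) (ht : t < q) (hh : 1 ≤ h) (hN : N < p)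
    (h6 : q * (x + h - 1) - t * p ≤ N) (hN0 : 0 ≤ N) : q * x - t * p ≤ N ∧ x < p := by
  have h1 : 0 ≤ q * (h - 1) := mul_nonneg hq.le (by omega)
  have h2 : q * (x + h - 1) = q * x + q * (h - 1) := by ring
  refine ⟨by linarith, ?_⟩
  by_contra hc
  push Not at hc
  have h3 : q * p ≤ q * x := mul_le_mul_of_nonneg_left hc hq.le
  have h4 : t * p ≤ (q - 1) * p := mul_le_mul_of_nonneg_right (by omega) (by omega)
  have h5 : (q - 1) * p = q * p - p := by ring
  linarith

lemma amgm_aux (a l : ℝ) : 4 * l ^ 3 * a - 3 * l ^ 4 ≤ a ^ 4 := by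
  have h : a ^ 4 - (4 * l ^ 3 * a - 3 * l ^ 4) = (a - l) ^ 2 * ((a + l) ^ 2 + 2 * l ^ 2) := by ring
  have : 0 ≤ (a - l) ^ 2 * ((a + l) ^ 2 + 2 * l ^ 2) := by positivity
  linarith

set_option linter.constructorNameAsVariable false in
set_option maxHeartbeats 1000000 in
/-- Burgess lattice inequality. -/
lemma burgess {p k s : ℕ} [hpp : Fact p.Prime] (hp : p = 3 * k + 1)
    (χ : DirichletCharacter ℂ p)
    (hχ : orderOf χ = 3) (hs : 1 ≤ s) (hsk : 11 * s ^ 2 ≤ 4 * (k - 1))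
    {h N Q : ℕ} (hh1 : 1 ≤ h) (hhp : h ≤ p) (hNp : N < p) (hQp : Q < p)
    (hN : 4 * (Q * h) ≤ 3 * N) (hN' : 10 ^ 6 ≤ N) (hQN : 2 * (Q * N) < p) {β m : ℝ}
    (hbad : ∀ y : ℕ, N ≤ 4 * y → y ≤ N → (badCount χ y : ℝ) ≤ β * y)
    (hm : m ≤ 1 - 1.5 * (β / 0.996)) (hm0 : 0 < m) :
    m ^ 4 * (h:ℝ) ^ 4 * ((((Finset.Ioc 300 Q).filter Nat.Prime).card : ℝ) * (1.245 * N)) ≤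
      2 * (h:ℝ) ^ 2 * p + (h : ℝ) ^ 4 * (2 * p / s + 2) := by
  classical
  refine le_trans ?_ (fourth_moment hp χ hχ hs hsk hhp)
  set P := (Finset.Ioc 300 Q).filter Nat.Prime with hP
  have hPm : ∀ q ∈ P, 300 < q ∧ q ≤ Q ∧ q.Prime := by
    intro q hq; simpa [hP, and_assoc] using hq
  have hqN : ∀ q ∈ P, 4 * (q * h) ≤ 3 * N := fun q hq =>
    (Nat.mul_le_mul_left 4 (Nat.mul_le_mul_right h (hPm q hq).2.1)).trans hN
  set T : Finset (Σ _ : ℕ, ℤ × ℤ) := P.sigma (fun q => Wq p h N q) with hT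
  -- lower bound on the first moment
  have t1 : m * h * T.card ≤ ∑ w ∈ T, ‖Asum χ h (w.2.2 : ZMod p)‖ := by
    rw [hT, Finset.sum_sigma, Finset.card_sigma]
    push_cast
    rw [Finset.mul_sum]
    refine Finset.sum_le_sum fun q hq => ?_
    obtain ⟨h1, h2, h3⟩ := hPm q hq
    exact window_sum χ hχ h3 (by omega) hNp (hqN q hq) h1 hN' hbad hm
  have t2 : (P.card : ℝ) * (1.245 * N) ≤ T.card := by
    rw [hT, Finset.card_sigma]
    push_cast
    rw [← nsmul_eq_mul, ← Finset.sum_const]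
    refine Finset.sum_le_sum fun q hq => ?_
    obtain ⟨h1, h2, h3⟩ := hPm q hq
    exact window_card h3 (by omega) hNp hh1 (hqN q hq) h1 hN'
  have t3 : ∑ w ∈ T, ‖Asum χ h (w.2.2 : ZMod p)‖ ^ 4 ≤ ∑ x, ‖Asum χ h x‖ ^ 4 := by
    have hinj : Set.InjOn (fun w : (Σ _ : ℕ, ℤ × ℤ) => ((w.2.2 : ℤ) : ZMod p)) T := by
      rintro ⟨q, t, x⟩ hw ⟨q', t', x'⟩ hw' e
      rw [hT, Finset.mem_coe, Finset.mem_sigma, mem_Wq] at hw hw'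
      obtain ⟨hq, ⟨⟨h1, h2⟩, h3, h4⟩, h5, h6⟩ := hw
      obtain ⟨hq', ⟨⟨h1', h2'⟩, h3', h4'⟩, h5', h6'⟩ := hw'
      simp only at *
      obtain ⟨g1, g2, g3⟩ := hPm q hq
      obtain ⟨g1', g2', g3'⟩ := hPm q' hq'
      have hhZ : (1:ℤ) ≤ h := by exact_mod_cast hh1
      have hNZ : (N:ℤ) < p := by exact_mod_cast hNp
      have hq0 : (0:ℤ) < q := by exact_mod_cast g3.pos
      have hq0' : (0:ℤ) < q' := by exact_mod_cast g3'.pos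
      obtain ⟨u1, u2⟩ := window_aux hq0 h2 hhZ hNZ h6 (by positivity)
      obtain ⟨u1', u2'⟩ := window_aux hq0' h2' hhZ hNZ h6' (by positivity)
      have hx : x = x' := by
        rw [ZMod.intCast_eq_intCast_iff_dvd_sub] at e
        have := Int.eq_zero_of_abs_lt_dvd e (by rw [abs_lt]; constructor <;> linarith)
        omega
      subst hx
      have hQZ : (q:ℤ) ≤ Q := by exact_mod_cast g2
      have hQZ' : (q':ℤ) ≤ Q := by exact_mod_cast g2'
      have hQNZ : 2 * ((Q:ℤ) * N) < p := by exact_mod_cast hQN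
      have hN0 : (0:ℤ) ≤ N := by positivity
      have hqN1 : (q:ℤ) * N ≤ Q * N := mul_le_mul_of_nonneg_right hQZ hN0
      have hqN2 : (q':ℤ) * N ≤ Q * N := mul_le_mul_of_nonneg_right hQZ' hN0
      have k1 : (q':ℤ) * (q * x - t * p) ≤ q' * N := mul_le_mul_of_nonneg_left u1 hq0'.le
      have k2 : (q':ℤ) * (-N) ≤ q' * (q * x - t * p) := mul_le_mul_of_nonneg_left h5 hq0'.le
      have k3 : (q:ℤ) * (q' * x - t' * p) ≤ q * N := mul_le_mul_of_nonneg_left u1' hq0.le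
      have k4 : (q:ℤ) * (-N) ≤ q * (q' * x - t' * p) := mul_le_mul_of_nonneg_left h5' hq0.le
      have hz : (q' * t - q * t') * (p:ℤ) = q * (q' * x - t' * p) - q' * (q * x - t * p) := by ring
      have hz0 : (q':ℤ) * t - q * t' = 0 := by
        have hp0 : (0:ℤ) < p := by linarith
        by_contra hne
        rcases lt_or_gt_of_ne hne with h | h
        · have : ((q':ℤ) * t - q * t') * p ≤ (-1) * p :=
            mul_le_mul_of_nonneg_right (by omega) hp0.le
          linarith
        · have : 1 * (p:ℤ) ≤ ((q':ℤ) * t - q * t') * p :=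
            mul_le_mul_of_nonneg_right (by omega) hp0.le
          linarith
      have hqq : q = q' := by
        have hd : (q:ℤ) ∣ q' * t := ⟨t', by linarith⟩
        rcases (Nat.prime_iff_prime_int.1 g3).dvd_or_dvd hd with h | h
        · exact (Nat.prime_dvd_prime_iff_eq g3 g3').1 (by exact_mod_cast h)
        · have := Int.le_of_dvd (by omega) h
          omega
      subst hqq
      have : t = t' := mul_left_cancel₀ hq0.ne' (by linarith : (q:ℤ) * t = q * t')
      rw [this]
    rw [← Finset.sum_image (f := fun y => ‖Asum χ h y‖ ^ 4)
      (g := fun w : (Σ _ : ℕ, ℤ × ℤ) => ((w.2.2 : ℤ) : ZMod p)) hinj]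
    exact Finset.sum_le_sum_of_subset_of_nonneg (Finset.subset_univ _) fun _ _ _ => pow_nonneg (norm_nonneg _) 4
  refine le_trans ?_ t3
  have hl : 0 < m * h := mul_pos hm0 (by exact_mod_cast hh1)
  have amgm : ∀ a : ℝ, 4 * (m * h) ^ 3 * a - 3 * (m * h) ^ 4 ≤ a ^ 4 := by
    exact fun a => amgm_aux a (m * h)
  have t4 : ∑ w ∈ T, (4 * (m * h) ^ 3 * ‖Asum χ h (w.2.2 : ZMod p)‖ - 3 * (m * h) ^ 4) ≤
     ∑ w ∈ T, ‖Asum χ h (w.2.2 : ZMod p)‖ ^ 4 := Finset.sum_le_sum fun w _ => amgm _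
  refine le_trans ?_ t4
  rw [Finset.sum_sub_distrib, ← Finset.mul_sum]
  simp only [Finset.sum_const, nsmul_eq_mul]
  have t5 : 4 * (m * h) ^ 3 * (m * h * T.card) ≤
     4 * (m * h) ^ 3 * ∑ w ∈ T, ‖Asum χ h (w.2.2 : ZMod p)‖ :=
    mul_le_mul_of_nonneg_left t1 (by positivity)
  have t6 : (m * h) ^ 4 * ((P.card : ℝ) * (1.245 * N)) ≤ (m * h) ^ 4 * T.card :=
    mul_le_mul_of_nonneg_left t2 (by positivity)
  have e1 : (m * h) ^ 4 = m ^ 4 * (h:ℝ) ^ 4 := by ring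
  have e2 : 4 * (m * h) ^ 3 * (m * h * T.card) = 4 * ((m * h) ^ 4 * T.card) := by ring
  rw [← e1]
  linarith
end PartE

section PartF

section bad
open Finset

noncomputable def LF (n : ℕ) : ℝ := ∑ k ∈ Ioc 0 n, Real.log k

noncomputable def vM (n : ℕ) : ℝ := ArithmeticFunction.vonMangoldt n

lemma vM_nonneg (n : ℕ) : 0 ≤ vM n := ArithmeticFunction.vonMangoldt_nonneg

lemma LF_eq (n : ℕ) : LF n = ∑ d ∈ Ioc 0 n, vM d * ((n / d : ℕ) : ℝ) := by
  have := ArithmeticFunction.sum_Ioc_mul_zeta_eq_sum (ArithmeticFunction.vonMangoldt) n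
  rw [ArithmeticFunction.vonMangoldt_mul_zeta] at this
  rw [LF, ← Finset.sum_congr rfl fun d _ => ArithmeticFunction.log_apply]
  exact this

lemma LF_succ (n : ℕ) : LF (n + 1) = LF n + Real.log (n + 1) := by
  rw [LF, LF, Finset.sum_Ioc_succ_top (by omega)]; simp

lemma LF_lower (n : ℕ) : n * Real.log n - n ≤ LF n := by
  induction n with
  | zero => simp [LF]
  | succ n ih =>
    rw [LF_succ]
    rcases Nat.eq_zero_or_pos n with rfl | hn
    · simp [LF]
    · have hn' : (0:ℝ) < n := by exact_mod_cast hn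
      have h := Real.log_le_sub_one_of_pos (show 0 < ((n:ℝ) + 1) / n by positivity)
      rw [Real.log_div (by positivity) (by positivity)] at h
      have h2 : n * (Real.log (n + 1) - Real.log n) ≤ n * ((n + 1) / n - 1) :=
        mul_le_mul_of_nonneg_left h hn'.le
      have h3 : n * (((n:ℝ) + 1) / n - 1) = 1 := by field_simp; ring
      push_cast
      nlinarith

lemma LF_upper (n : ℕ) (hn : 1 ≤ n) : LF n ≤ n * Real.log n - n + Real.log n + 1 := by
  induction n, hn using Nat.le_induction with
  | base => simp [LF]
  | succ n hn ih =>
    rw [LF_succ]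
    have hn' : (0:ℝ) < n := by exact_mod_cast hn
    have h := Real.one_sub_inv_le_log_of_pos (show 0 < ((n:ℝ) + 1) / n by positivity)
    rw [Real.log_div (by positivity) (by positivity)] at h
    have h2 : (n + 1) * (1 - (((n:ℝ) + 1) / n)⁻¹) ≤ (n + 1) * (Real.log (n + 1) - Real.log n) :=
      mul_le_mul_of_nonneg_left h (by positivity)
    have h3 : (n + 1) * (1 - (((n:ℝ) + 1) / n)⁻¹) = 1 := by field_simp; ring
    push_cast
    nlinarith

lemma psi_nat (n : ℕ) : Chebyshev.psi n = ∑ d ∈ Ioc 0 n, vM d := by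
  rw [Chebyshev.psi, Nat.floor_natCast]; rfl

lemma psi_bound (n : ℕ) (hn : 1800000 ≤ n) : ∑ d ∈ Ioc 0 n, vM d + Real.log n + 1 ≤ 1.41 * n := by
  rw [← psi_nat]
  have hnR : (1800000:ℝ) ≤ n := by exact_mod_cast hn
  have h1 := Chebyshev.psi_le (x := n) (by linarith)
  have he : Real.exp 2 ≤ 1800000 := by
    have : Real.exp 2 = Real.exp 1 * Real.exp 1 := by rw [← Real.exp_add]; norm_num
    rw [this]
    have := Real.exp_one_lt_d9
    have := Real.exp_pos 1
    nlinarith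
  have h2 := Real.log_div_sqrt_antitoneOn (Set.mem_Ici.2 he) (Set.mem_Ici.2 (he.trans hnR)) hnR
  simp only at h2
  have hs : (1341:ℝ) ≤ √1800000 := by
    rw [Real.le_sqrt (by norm_num) (by norm_num)]; norm_num
  have l2 := Real.log_two_lt_d9
  have hl : Real.log 1800000 ≤ 14.6 := by
    have : Real.log ((1800000:ℝ)) ≤ Real.log (2 ^ 21) := Real.log_le_log (by norm_num) (by norm_num)
    rw [Real.log_pow] at this
    push_cast at this
    linarith
  have hl4 : Real.log 4 ≤ 1.3863 := by
    have : Real.log 4 = 2 * Real.log 2 := by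
      rw [show (4:ℝ) = 2 ^ 2 by norm_num, Real.log_pow]; norm_num
    linarith
  have h3 : Real.log 1800000 / √1800000 ≤ 14.6 / 1341 := by
    gcongr
  have hsn : 0 < √(n:ℝ) := Real.sqrt_pos.2 (by linarith)
  have h4 : Real.log n ≤ (14.6 / 1341) * √n := by
    rw [← div_le_iff₀ hsn]; exact h2.trans h3
  have h5 : √(n:ℝ) * √n = n := Real.mul_self_sqrt (by linarith)
  have h7 : (1341:ℝ) ≤ √n := hs.trans (Real.sqrt_le_sqrt hnR)
  have h6 : 2 * √(n:ℝ) * Real.log n ≤ 2 * (14.6 / 1341) * n := by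
    nlinarith
  nlinarith

/-- Mertens lower bound -/
lemma M_lower (b : ℕ) (hb : 1 ≤ b) : Real.log b - 1 ≤ ∑ d ∈ Ioc 0 b, vM d / d := by
  have h1 := LF_lower b
  have hb' : (0:ℝ) < b := by exact_mod_cast hb
  have h2 : LF b ≤ b * ∑ d ∈ Ioc 0 b, vM d / d := by
    rw [LF_eq, Finset.mul_sum]
    refine Finset.sum_le_sum fun d _ => ?_
    have : ((b / d : ℕ) : ℝ) ≤ b / d := Nat.cast_div_le
    calc _ ≤ vM d * (b / d) := mul_le_mul_of_nonneg_left this (vM_nonneg d)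
      _ = _ := by ring
  have h3 : b * (Real.log b - 1) ≤ b * ∑ d ∈ Ioc 0 b, vM d / d := by linarith
  exact le_of_mul_le_mul_left h3 hb'

lemma sub_le_div (y d : ℕ) : (y:ℝ) / d - 1 ≤ ((y / d : ℕ) : ℝ) := by
  rcases Nat.eq_zero_or_pos d with rfl | hd
  · simp
  have h := Nat.div_add_mod y d
  have h2 := Nat.mod_lt y hd
  have hd' : (0:ℝ) < d := by exact_mod_cast hd
  rw [sub_le_iff_le_add, div_le_iff₀ hd']
  have : y ≤ (y / d + 1) * d := by nlinarith
  exact_mod_cast this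

lemma M_upper (t : ℕ) (ht : 1800000 ≤ t) :
    ∑ d ∈ Ioc 0 t, vM d / d ≤ Real.log t - 1 + 1.41 := by
  have h1 := LF_upper t (by omega)
  have ht' : (0:ℝ) < t := by exact_mod_cast (by omega)
  have h2 : t * ∑ d ∈ Ioc 0 t, vM d / d - ∑ d ∈ Ioc 0 t, vM d ≤ LF t := by
    rw [LF_eq, Finset.mul_sum, ← Finset.sum_sub_distrib]
    refine Finset.sum_le_sum fun d _ => ?_
    have := sub_le_div t d
    calc _ = vM d * (t / d - 1) := by ring
      _ ≤ _ := mul_le_mul_of_nonneg_left this (vM_nonneg d)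
  have h3 := psi_bound t ht
  have : t * ∑ d ∈ Ioc 0 t, vM d / d ≤ t * (Real.log t - 1 + 1.41) := by nlinarith
  exact le_of_mul_le_mul_left this ht'

noncomputable def Sp (b y t : ℕ) : ℝ := ∑ d ∈ Ioc b t, vM d * ((y / d : ℕ) : ℝ)

lemma Sp_le (b y t : ℕ) (hb : 1800000 ≤ b) (hbt : b ≤ t) :
    Sp b y t ≤ y * (Real.log t - Real.log b + 1.41) := by
  have h1 := M_lower b (by omega)
  have h2 := M_upper t (by omega)
  have h3 : Sp b y t ≤ y * ∑ d ∈ Ioc b t, vM d / d := by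
    rw [Sp, Finset.mul_sum]
    refine Finset.sum_le_sum fun d _ => ?_
    have : ((y / d : ℕ) : ℝ) ≤ y / d := Nat.cast_div_le
    calc _ ≤ vM d * (y / d) := mul_le_mul_of_nonneg_left this (vM_nonneg d)
      _ = _ := by ring
  have h4 := Finset.sum_Ioc_consecutive (fun d => vM d / (d:ℝ)) (Nat.zero_le b) hbt
  refine h3.trans (mul_le_mul_of_nonneg_left ?_ (by positivity))
  linarith

lemma Sp_full (b y : ℕ) (hb : 1800000 ≤ b) (hby : 1500 * b ≤ y) :
    Sp b y y ≤ y * (Real.log y - Real.log b + 0.001) := by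
  have h1 := M_lower b (by omega)
  have h2 := LF_upper y (by omega)
  have h3 := psi_bound b hb
  have hbR : (1800000:ℝ) ≤ b := by exact_mod_cast hb
  have hyR : (1500 * b:ℝ) ≤ y := by exact_mod_cast hby
  have h4 := Finset.sum_Ioc_consecutive (fun d => vM d * ((y / d : ℕ) : ℝ)) (Nat.zero_le b)
    (show b ≤ y by omega)
  rw [← LF_eq] at h4
  have h5 : y * ∑ d ∈ Ioc 0 b, vM d / d - ∑ d ∈ Ioc 0 b, vM d ≤
     ∑ d ∈ Ioc 0 b, vM d * ((y / d : ℕ) : ℝ) := by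
    rw [Finset.mul_sum, ← Finset.sum_sub_distrib]
    refine Finset.sum_le_sum fun d _ => ?_
    have := sub_le_div y d
    calc _ = vM d * (y / d - 1) := by ring
      _ ≤ _ := mul_le_mul_of_nonneg_left this (vM_nonneg d)
  have h6 : (y:ℝ) * (Real.log b - 1) ≤ y * ∑ d ∈ Ioc 0 b, vM d / d :=
    mul_le_mul_of_nonneg_left h1 (by positivity)
  have hlb : 0 ≤ Real.log b := Real.log_nonneg (by linarith)
  have hy2 : Real.log y + 1 ≤ 0.00001 * y := by
    have h8 := Real.log_le_sub_one_of_pos (show (0:ℝ) < y / 10^8 by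
      apply div_pos <;> linarith)
    rw [Real.log_div (by linarith) (by norm_num), Real.log_pow] at h8
    have : Real.log 10 ≤ 3 := by
      have : Real.log 10 ≤ Real.log (2^4) := Real.log_le_log (by norm_num) (by norm_num)
      rw [Real.log_pow] at this
      have := Real.log_two_lt_d9
      push_cast at *
      linarith
    push_cast at h8
    linarith
  rw [Sp]
  nlinarith

lemma w_anti {d : ℕ} (hd : 2 ≤ d) : 1 / Real.log (d + 1 : ℕ) ≤ 1 / Real.log d := by
  have : (1:ℝ) < d := by exact_mod_cast hd
  apply one_div_le_one_div_of_le (Real.log_pos this)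
  apply Real.log_le_log (by linarith)
  push_cast; linarith

/-- Abel summation estimate. -/
lemma abel_est (b y : ℕ) (hb : 1800000 ≤ b) (t : ℕ) (hbt : b ≤ t) :
    ∑ d ∈ Ioc b t, vM d * ((y / d : ℕ) : ℝ) * (1 / Real.log d) ≤
      Sp b y t * (1 / Real.log t) + y * (Real.log (Real.log t) - Real.log (Real.log b) +
        (1.41 - Real.log b) * (1 / Real.log b - 1 / Real.log t)) := by
  induction t, hbt using Nat.le_induction with
  | base => simp [Sp]
  | succ t hbt ih =>
    rw [Finset.sum_Ioc_succ_top (by omega)]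
    have hS : Sp b y (t + 1) = Sp b y t + vM (t + 1) * ((y / (t + 1) : ℕ) : ℝ) := by
      rw [Sp, Finset.sum_Ioc_succ_top (by omega), ← Sp]
    have h1 := Sp_le b y t hb hbt
    have h2 := w_anti (d := t) (by omega)
    have ht1 : (1:ℝ) < t := by exact_mod_cast (by omega)
    have hlt : 0 < Real.log t := Real.log_pos ht1
    have hlt' : 0 < Real.log (t + 1 : ℕ) := Real.log_pos (by push_cast; linarith)
    have h3 : Sp b y t * (1 / Real.log t - 1 / Real.log (t + 1 : ℕ)) ≤
       y * (Real.log t - Real.log b + 1.41) * (1 / Real.log t - 1 / Real.log (t + 1 : ℕ)) :=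
      mul_le_mul_of_nonneg_right h1 (by linarith)
    have h4 : Real.log t * (1 / Real.log t - 1 / Real.log (t + 1 : ℕ)) ≤
        Real.log (Real.log (t + 1 : ℕ)) - Real.log (Real.log t) := by
      have := Real.one_sub_inv_le_log_of_pos (div_pos hlt' hlt)
      rw [Real.log_div hlt'.ne' hlt.ne', inv_div] at this
      refine le_trans (le_of_eq ?_) this
      field_simp
    have h5 := mul_le_mul_of_nonneg_left h4 (show (0:ℝ) ≤ y by positivity)
    rw [hS]
    nlinarith

lemma prime_sum (b y : ℕ) (hb : 1800000 ≤ b) (hby : 1500 * b ≤ y) :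
    ∑ q ∈ (Ioc b y).filter Nat.Prime, ((y / q : ℕ) : ℝ) ≤
      y * (Real.log (Real.log y / Real.log b) + 1.41 * (1 / Real.log b) - 1.409 * (1 / Real.log y)) := by
  have h1   := abel_est b y hb y (by omega)
  have h2 := Sp_full b y hb hby
  have hbR : (1800000:ℝ) ≤ b := by exact_mod_cast hb
  have hyR : (1500 * b:ℝ) ≤ y := by exact_mod_cast hby
  have hlb : 0 < Real.log b := Real.log_pos (by linarith)
  have hly : 0 < Real.log y := Real.log_pos (by linarith)
  have h3 : ∑ q ∈ (Ioc b y).filter Nat.Prime, ((y / q : ℕ) : ℝ) ≤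
      ∑ d ∈ Ioc b y, vM d * ((y / d : ℕ) : ℝ) * (1 / Real.log d) := by
    rw [Finset.sum_filter]
    refine Finset.sum_le_sum fun d hd => ?_
    have hd' : (1:ℝ) < d := by
      have := (Finset.mem_Ioc.1 hd).1
      exact_mod_cast (by omega)
    have hld := Real.log_pos hd'
    split_ifs with hp
    · rw [vM, ArithmeticFunction.vonMangoldt_apply_prime hp]
      apply le_of_eq; field_simp
    · have := vM_nonneg d
      positivity
  refine h3.trans (h1.trans ?_)
  rw [Real.log_div hly.ne' hlb.ne']
  have h4 : Sp b y y * (1 / Real.log y) ≤ y * (Real.log y - Real.log b + 0.001) * (1 / Real.log y) :=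
    mul_le_mul_of_nonneg_right h2 (by positivity)
  have e1 : Real.log y * (1 / Real.log y) = 1 := by field_simp
  have e2 : Real.log b * (1 / Real.log b) = 1 := by field_simp
  have e3 : y * (Real.log y - Real.log b + 0.001) * (1 / Real.log y) =
    y * (1 - Real.log b * (1 / Real.log y) + 0.001 * (1 / Real.log y)) := by
    linear_combination (y:ℝ) * e1
  have e4 : (1.41 - Real.log b) * (1 / Real.log b - 1 / Real.log y) =
     1.41 * (1 / Real.log b) - 1 - 1.41 * (1 / Real.log y) + Real.log b * (1 / Real.log y) := by
    linear_combination (-1) * e2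
  rw [e3] at h4
  rw [e4]
  nlinarith
end bad
end PartF

section PartG

section final
open Finset

lemma chi_prod {f : ℕ} (χ : DirichletCharacter ℂ f) (n : ℕ) :
    n ≠ 0 → (∀ p : ℕ, p.Prime → p ∣ n → χ (p : ZMod f) = 1) → χ (n : ZMod f) = 1 := by
  induction n using induction_on_primes with
  | zero => intro h; exact absurd rfl h
  | one => intro _ _; simp
  | prime_mul p a hp ih =>
    intro h0 h
    have h1 := h p hp (dvd_mul_right _ _)
    have h2 := ih (right_ne_zero_of_mul h0) fun q hq hd => h q hq (hd.mul_left _)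
    rw [Nat.cast_mul, map_mul, h1, h2, one_mul]

lemma bad_le (f : ℕ) [hf : Fact f.Prime]
    (χ : DirichletCharacter ℂ f)
    (q₁ q₂ : ℕ) 
    (hq₁min : ∀ p : ℕ, p.Prime → p < q₁ → χ (p : ZMod f) = 0 ∨ χ (p : ZMod f) = 1)
    (hq₂min : ∀ p : ℕ, p.Prime → q₁ < p → p < q₂ → χ (p : ZMod f) = 0 ∨ χ (p : ZMod f) = 1)
    (h293 : 293 ≤ q₁) (b y : ℕ) (hb : b < q₂) (hy : y < f) :
    (badCount χ y : ℝ) ≤ y * (1 / 293) + ∑ q ∈ (Ioc b y).filter Nat.Prime, ((y / q : ℕ) : ℝ) := by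
  classical
  have hsub : ((Finset.Icc 1 y).filter fun n : ℕ => χ (n : ZMod f) ≠ 1) ⊆
      ((Ioc 0 y).filter fun n => q₁ ∣ n) ∪
        ((Ioc b y).filter Nat.Prime).biUnion fun q => (Ioc 0 y).filter fun n => q ∣ n := by
    intro n hn
    rw [Finset.mem_filter, Finset.mem_Icc] at hn
    obtain ⟨⟨h1, h2⟩, h3⟩ := hn
    have : ∃ p : ℕ, p.Prime ∧ p ∣ n ∧ χ (p : ZMod f) ≠ 1 := by
      by_contra hc
      push Not at hc
      exact h3 (chi_prod χ n (by omega) hc)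
    obtain ⟨p, hp, hpn, hp1⟩ := this
    have hpy : p ≤ n := Nat.le_of_dvd (by omega) hpn
    have hp0 : χ (p : ZMod f) ≠ 0 := by
      have hu : IsUnit (p : ZMod f) := by
        rw [isUnit_iff_ne_zero]
        intro h
        rw [ZMod.natCast_eq_zero_iff] at h
        have := Nat.le_of_dvd hp.pos h
        omega
      exact (hu.map χ).ne_zero
    rw [Finset.mem_union]
    rcases lt_trichotomy p q₁ with h | h | h
    · rcases hq₁min p hp h with h | h
      · exact absurd h hp0
      · exact absurd h hp1
    · left; subst h; simp [hpn]; omega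
    · right
      rcases lt_or_ge p q₂ with h' | h'
      · rcases hq₂min p hp h h' with h | h
        · exact absurd h hp0
        · exact absurd h hp1
      · simp only [Finset.mem_biUnion, Finset.mem_filter, Finset.mem_Ioc]
        exact ⟨p, ⟨⟨by omega, by omega⟩, hp⟩, ⟨by omega, h2⟩, hpn⟩
  have h1 : badCount χ y ≤ y / q₁ + ∑ q ∈ (Ioc b y).filter Nat.Prime, y / q := by
    unfold badCount
    refine (Finset.card_le_card (by convert hsub)).trans ((Finset.card_union_le _ _).trans ?_)
    refine Nat.add_le_add (by rw [Nat.Ioc_filter_dvd_card_eq_div]) ?_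
    refine Finset.card_biUnion_le.trans (Finset.sum_le_sum fun q _ => ?_)
    rw [Nat.Ioc_filter_dvd_card_eq_div]
  have h2 : (badCount χ y : ℝ) ≤ ((y / q₁ : ℕ) : ℝ) + ∑ q ∈ (Ioc b y).filter Nat.Prime, ((y / q : ℕ) : ℝ) := by
    exact_mod_cast h1
  have h3 : ((y / q₁ : ℕ) : ℝ) ≤ y * (1 / 293) := by
    have h293' : (293:ℝ) ≤ q₁ := by exact_mod_cast h293
    calc ((y / q₁ : ℕ) : ℝ) ≤ (y:ℝ) / q₁ := Nat.cast_div_le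
      _ ≤ (y:ℝ) / 293 := by gcongr
      _ = _ := by ring
  linarith

lemma log_est {a : ℝ} (ha : 0 < a) (n m : ℕ) (hn : 0 < n) (h : a ^ n ≤ 2 ^ m) :
    Real.log a ≤ (m:ℝ) / n * Real.log 2 := by
  have h1 := Real.log_le_log (pow_pos ha n) h
  rw [Real.log_pow, Real.log_pow] at h1
  have : (0:ℝ) < n := by exact_mod_cast hn
  rw [div_mul_eq_mul_div, le_div_iff₀ this]; linarith

lemma log_est' {a : ℝ} (ha : 0 < a) (n m : ℕ) (hn : 0 < n) (h : 2 ^ m ≤ a ^ n) :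
    (m:ℝ) / n * Real.log 2 ≤ Real.log a := by
  have h1 := Real.log_le_log (by positivity) h
  rw [Real.log_pow, Real.log_pow] at h1
  have : (0:ℝ) < n := by exact_mod_cast hn
  rw [div_mul_eq_mul_div, div_le_iff₀ this]; linarith

lemma beta_num {lb ly : ℝ} (hlb : 14.4 ≤ lb) (hly : 0 < ly) (h : ly ≤ 1.665 * lb) :
    1 / 293 + (Real.log (ly / lb) + 1.41 * (1 / lb) - 1.409 * (1 / ly)) ≤ 0.553 := by
  have l2 := Real.log_two_lt_d9
  have h0 : 0 < lb := by linarith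
  have h1 : Real.log (ly / lb) ≤ Real.log 1.665 := by
    apply Real.log_le_log (by positivity)
    rw [div_le_iff₀ h0]; exact h
  have h2 := log_est (a := 1.665) (by norm_num) 250 184 (by norm_num) (by norm_num)
  norm_num at h2
  have h3 : 1 / (1.665 * lb) ≤ 1 / ly := one_div_le_one_div_of_le hly h
  have h4 : 1 / (1.665 * lb) = (1 / 1.665) * (1 / lb) := by field_simp
  have h5 : 1 / lb ≤ 1 / 14.4 := one_div_le_one_div_of_le (by norm_num) hlb
  rw [h4] at h3
  norm_num at *
  linarith

lemma primes_count (Q : ℕ) (hQ2 : 2 ≤ Q) (hQ : Q + 1 ≤ 2 ^ 31) :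
    (Q:ℝ) / 31 - 302 ≤ (((Finset.Ioc 300 Q).filter Nat.Prime).card : ℝ) := by
  have h1 := Chebyshev.pi_ge Q
  have hQR : (2:ℝ) ≤ Q := by exact_mod_cast hQ2
  have hQR' : (Q:ℝ) + 1 ≤ 2 ^ 31 := by exact_mod_cast hQ
  have hl : 0 < Real.log Q := Real.log_pos (by linarith)
  have l2 : 0 < Real.log 2 := Real.log_pos (by norm_num)
  have h2 : Real.log (Q + 1) ≤ 31 * Real.log 2 := by
    have := Real.log_le_log (by positivity) hQR'
    rw [Real.log_pow] at this
    exact_mod_cast this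
  have h3 : Real.log Q ≤ Real.log (Q + 1) := Real.log_le_log (by linarith) (by linarith)
  rw [div_le_iff₀ hl] at h1
  have h4 : (Nat.primeCounting Q : ℝ) * Real.log Q ≤ Nat.primeCounting Q * (31 * Real.log 2) :=
    mul_le_mul_of_nonneg_left (h3.trans h2) (by positivity)
  have h5 : ((Q:ℝ) - 31) * Real.log 2 ≤ (31 * Nat.primeCounting Q) * Real.log 2 := by linarith
  have h6 := le_of_mul_le_mul_right h5 l2
  have h7 : Nat.primeCounting Q ≤ 301 + ((Finset.Ioc 300 Q).filter Nat.Prime).card := by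
    have e : Nat.primeCounting Q = ((Finset.range (Q + 1)).filter Nat.Prime).card := by
      rw [Nat.primeCounting, Nat.primeCounting', Nat.count_eq_card_filter_range]
    rw [e]
    have : (Finset.range (Q + 1)).filter Nat.Prime ⊆ Finset.range 301 ∪ (Finset.Ioc 300 Q).filter Nat.Prime := by
      intro q hq
      simp only [Finset.mem_filter, Finset.mem_range, Finset.mem_union, Finset.mem_Ioc] at *
      by_cases h : q < 301
      · left; exact h
      · right; exact ⟨⟨by omega, by omega⟩, hq.2⟩
    refine (Finset.card_le_card this).trans ((Finset.card_union_le _ _).trans ?_)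
    simp
  have h8 : (Nat.primeCounting Q : ℝ) ≤ 301 + ((Finset.Ioc 300 Q).filter Nat.Prime).card := by
    exact_mod_cast h7
  linarith

lemma exists_s {p k : ℕ} (hp : p = 3 * k + 1) {v : ℝ} (hv : (10:ℝ) ^ 8 ≤ v) (hvp : v ^ 2 = p) :
    ∃ s : ℕ, 1 ≤ s ∧ 11 * s ^ 2 ≤ 4 * (k - 1) ∧ 0.347 * v ≤ s := by
  have hk : 1 ≤ k := by
    by_contra hc
    have : k = 0 := by omega
    subst this
    rw [hp] at hvp; norm_num at hvp hv; rcases hvp with h | h <;> linarith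
  refine ⟨Nat.sqrt (4 * (k - 1) / 11), ?_⟩
  set s := Nat.sqrt (4 * (k - 1) / 11) with hs
  have h1 : s ^ 2 ≤ 4 * (k - 1) / 11 := Nat.sqrt_le' _
  have h2 : 4 * (k - 1) / 11 < (s + 1) ^ 2 := Nat.lt_succ_sqrt' _
  have h3 : 4 * (k - 1) < 11 * (s + 1) ^ 2 := by omega
  have h4 : 4 * k < 11 * (s + 1) ^ 2 + 4 := by omega
  have h5 : (4 * k : ℝ) < 11 * (s + 1) ^ 2 + 4 := by exact_mod_cast h4
  have h6 : (p:ℝ) = 3 * k + 1 := by rw [hp]; push_cast; ring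
  have h7 : 0.347 * v ≤ s := by
    by_contra hc
    push Not at hc
    have h8 : ((s:ℝ) + 1) ^ 2 ≤ (0.34701 * v) ^ 2 := by
      apply pow_le_pow_left₀ (by positivity); linarith
    nlinarith
  refine ⟨?_, by omega, h7⟩
  have : (1:ℝ) ≤ s := by linarith
  exact_mod_cast this
end final
end PartG

section PartH

lemma u_facts {f : ℝ} (hf1 : 2 * 10 ^ 20 ≤ f) (hf2 : f ≤ 4 * 10 ^ 49) :
    ∃ u : ℝ, 344 ≤ u ∧ u ≤ 1600000 ∧ u ^ 8 = f ∧ Real.log u = Real.log f / 8 ∧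
      f ^ (0.232 : ℝ) ≤ u ^ 2 := by
  have hf0 : 0 < f := by linarith
  refine ⟨f ^ ((1:ℝ) / 8), ?_, ?_, ?_, ?_, ?_⟩
  · by_contra hc
    push Not at hc
    have := pow_lt_pow_left₀ hc (by positivity) (show 8 ≠ 0 by norm_num)
    rw [← Real.rpow_mul_natCast hf0.le] at this
    norm_num at this
    linarith
  · by_contra hc
    push Not at hc
    have := pow_lt_pow_left₀ hc (by positivity) (show 8 ≠ 0 by norm_num)
    rw [← Real.rpow_mul_natCast hf0.le] at this
    norm_num at this
    linarith
  · rw [← Real.rpow_mul_natCast hf0.le]; norm_num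
  · rw [Real.log_rpow hf0]; ring
  · rw [← Real.rpow_mul_natCast hf0.le]
    apply Real.rpow_le_rpow_of_exponent_le
    · linarith
    · norm_num

set_option exponentiation.threshold 10000 in
lemma b_facts {f : ℝ} (hf1 : 2 * 10 ^ 20 ≤ f) :
    50000 ≤ f ^ (0.232 : ℝ) ∧ 46.738 ≤ Real.log f := by
  have hf0 : 0 < f := by linarith
  have h1 : Real.log (2 * 10 ^ 20) ≤ Real.log f := Real.log_le_log (by norm_num) hf1
  have l2 := Real.log_two_gt_d9
  constructor
  · rw [← Real.log_le_log_iff (by norm_num) (by positivity), Real.log_rpow hf0]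
    have h2 : Real.log ((50000:ℝ) ^ 125) ≤ Real.log ((2 * 10 ^ 20) ^ 29) :=
      Real.log_le_log (by norm_num) (by norm_num)
    rw [Real.log_pow, Real.log_pow] at h2
    push_cast at h2
    linarith
  · have := log_est' (a := 2 * 10 ^ 20) (by norm_num) 100 6743 (by norm_num) (by norm_num)
    norm_num at this h1
    linarith

lemma final_ineq {h N u p s c : ℝ} (hu : 344 ≤ u) (hp : u ^ 8 = p) (hh : 0.599 * u ^ 2 ≤ h)
    (hN : 679 * u ^ 3 ≤ N) (hc : 26.5 * u ≤ c) (hs : 0.347 * u ^ 4 ≤ s)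
    (H : (0.165:ℝ) ^ 4 * h ^ 4 * (c * (1.245 * N)) ≤ 2 * h ^ 2 * p + h ^ 4 * (2 * p / s + 2)) :
    False := by
  have hu0 : 0 < u := by linarith
  have hh0 : 0 < h := lt_of_lt_of_le (by positivity) hh
  have hs0 : 0 < s := lt_of_lt_of_le (by positivity) hs
  have hc0 : 0 ≤ c := le_trans (by positivity) hc
  have h1 : 16.5 * u ^ 4 ≤ (0.165:ℝ) ^ 4 * (c * (1.245 * N)) := by
    have : (26.5 * u) * (1.245 * (679 * u ^ 3)) ≤ c * (1.245 * N) := by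
      gcongr
    nlinarith [pow_pos hu0 4]
  have h2 : 2 * p / s ≤ 5.77 * u ^ 4 := by
    rw [div_le_iff₀ hs0, ← hp]
    nlinarith [pow_pos hu0 4, mul_le_mul_of_nonneg_left hs (pow_pos hu0 4).le]
  have h3 : p ≤ h ^ 2 * (2.8 * u ^ 4) := by
    have : (0.599 * u ^ 2) ^ 2 ≤ h ^ 2 := by gcongr
    rw [← hp]
    nlinarith [pow_pos hu0 4, mul_le_mul_of_nonneg_right this (pow_pos hu0 4).le]
  have h4 : (344:ℝ) ^ 4 ≤ u ^ 4 := by gcongr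
  have h5 : 2 * h ^ 2 * p ≤ h ^ 4 * (5.6 * u ^ 4) := by
    nlinarith [mul_le_mul_of_nonneg_left h3 (pow_pos hh0 2).le]
  have h6 : h ^ 4 * (16.5 * u ^ 4) ≤ h ^ 4 * ((0.165:ℝ) ^ 4 * (c * (1.245 * N))) :=
    mul_le_mul_of_nonneg_left h1 (by positivity)
  have h7 : h ^ 4 * (2 * p / s + 2) ≤ h ^ 4 * (5.77 * u ^ 4 + 2) :=
    mul_le_mul_of_nonneg_left (by linarith) (by positivity)
  have h8 : h ^ 4 * (16.5 * u ^ 4) ≤ h ^ 4 * (11.37 * u ^ 4 + 2) := by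
    nlinarith
  have h9 := le_of_mul_le_mul_left h8 (pow_pos hh0 4)
  linarith

set_option maxHeartbeats 4000000 in
theorem q2_upper_bound (f : ℕ) (hf : f.Prime)
    (hf1 : 2 * 10 ^ 20 ≤ f) (hf2 : f ≤ 4 * 10 ^ 49)
    (χ : DirichletCharacter ℂ f) (hχ : orderOf χ = 3)
    (q₁ q₂ : ℕ) (hq₁p : q₁.Prime)
    (hq₁nr : χ (q₁ : ZMod f) ≠ 0 ∧ χ (q₁ : ZMod f) ≠ 1)
    (hq₁min : ∀ p : ℕ, p.Prime → p < q₁ → χ (p : ZMod f) = 0 ∨ χ (p : ZMod f) = 1)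
    (hq₁₂ : q₁ < q₂) (hq₂p : q₂.Prime)
    (hq₂nr : χ (q₂ : ZMod f) ≠ 0 ∧ χ (q₂ : ZMod f) ≠ 1)
    (hq₂min : ∀ p : ℕ, p.Prime → q₁ < p → p < q₂ → χ (p : ZMod f) = 0 ∨ χ (p : ZMod f) = 1)
    (h293 : 293 ≤ q₁) :
    q₁ ≤ q₂ ∧ (q₂ : ℝ) ≤ 37 * (f : ℝ) ^ (0.232 : ℝ) := by
  refine ⟨hq₁₂.le, ?_⟩
  by_contra hcon
  push Not at hcon
  have hpp : Fact f.Prime := ⟨hf⟩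
  obtain ⟨k, hk⟩ := chi_mod3 χ hχ
  have hf1' : (2:ℝ) * 10 ^ 20 ≤ f := by exact_mod_cast hf1
  have hf2' : (f:ℝ) ≤ 4 * 10 ^ 49 := by exact_mod_cast hf2
  have hf0 : (0:ℝ) < f := by linarith
  obtain ⟨u, hu1, hu2, hu8, hlu, hu232⟩ := u_facts hf1' hf2'
  obtain ⟨hB, hL⟩ := b_facts hf1'
  have hu0 : 0 < u := by linarith
  set F := (f:ℝ) ^ (0.232 : ℝ) with hF
  -- the cutoff b
  set b := ⌊37 * F⌋₊ with hb
  have hb1 : (b:ℝ) ≤ 37 * F := Nat.floor_le (by positivity)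
  have hb2 : 37 * F < b + 1 := Nat.lt_floor_add_one _
  have hb3 : 36.99 * F ≤ b := by linarith
  have hbq : b < q₂ := by
    have : (b:ℝ) < q₂ := by linarith
    exact_mod_cast this
  have hb18 : 1800000 ≤ b := by
    have : (1800000:ℝ) ≤ b := by linarith
    exact_mod_cast this
  have l2 := Real.log_two_gt_d9
  have l2' := Real.log_two_lt_d9
  have hlb : 3.6099 + 0.232 * Real.log f ≤ Real.log b := by
    have h1 := Real.log_le_log (show 0 < 36.99 * F by positivity) hb3
    rw [Real.log_mul (by norm_num) (by positivity), hF, Real.log_rpow hf0] at h1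
    have h2 := log_est' (a := 36.99) (by norm_num) 24 125 (by norm_num) (by norm_num)
    norm_num at h1 h2
    norm_num
    linarith
  -- the parameters
  have hu2m : (344:ℝ) ^ 2 ≤ u ^ 2 := by gcongr
  set h' := ⌊u ^ 2 / 5⌋₊ with hh'
  have hh1 : (h':ℝ) ≤ u ^ 2 / 5 := Nat.floor_le (by positivity)
  have hh2 : u ^ 2 / 5 < h' + 1 := Nat.lt_floor_add_one _
  have hh3 : 0.1999 * u ^ 2 ≤ h' := by nlinarith
  set Q := ⌊850 * u⌋₊ with hQ
  have hQ1 : (Q:ℝ) ≤ 850 * u := Nat.floor_le (by positivity)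
  have hQ2 : 850 * u < Q + 1 := Nat.lt_floor_add_one _
  have hQ3 : 849.99 * u ≤ Q := by linarith
  set N := 4 * h' * Q with hN
  have hNR : (N:ℝ) = 4 * h' * Q := by rw [hN]; push_cast; ring
  have hN1 : (N:ℝ) ≤ 680 * u ^ 3 := by
    rw [hNR]
    calc (4:ℝ) * h' * Q ≤ 4 * (u ^ 2 / 5) * (850 * u) := by gcongr
      _ = _ := by ring
  have hN2 : 679 * u ^ 3 ≤ (N:ℝ) := by
    rw [hNR]
    calc 679 * u ^ 3 ≤ 4 * (0.1999 * u ^ 2) * (849.99 * u) := by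
          nlinarith [pow_pos hu0 3]
      _ ≤ _ := by gcongr
  have hu3 : (344:ℝ) ^ 3 ≤ u ^ 3 := by gcongr
  have hu4 : (344:ℝ) ^ 4 ≤ u ^ 4 := by gcongr
  have hu7 : (344:ℝ) ^ 7 ≤ u ^ 7 := by gcongr
  have hu5 : (344:ℝ) ^ 5 ≤ u ^ 5 := by gcongr
  have hu6 : (344:ℝ) ^ 6 ≤ u ^ 6 := by gcongr
  have hNf : N < f := by
    have : (N:ℝ) < f := by
      rw [← hu8]
      nlinarith [pow_pos hu0 3, mul_le_mul_of_nonneg_left hu5 (pow_pos hu0 3).le]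
    exact_mod_cast this
  have hQf : Q < f := by
    have : (Q:ℝ) < f := by
      rw [← hu8]
      nlinarith [mul_le_mul_of_nonneg_left hu7 hu0.le]
    exact_mod_cast this
  have hhf : 3 * h' ≤ f := by
    have : (3 * h':ℝ) ≤ f := by
      rw [← hu8]
      nlinarith [pow_pos hu0 2, mul_le_mul_of_nonneg_left hu6 (pow_pos hu0 2).le]
    exact_mod_cast this
  have hh0 : 1 ≤ 3 * h' := by
    have : (1:ℝ) ≤ 3 * h' := by linarith
    exact_mod_cast this
  have hN6 : 10 ^ 6 ≤ N := by
    have : (10:ℝ) ^ 6 ≤ N := by linarith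
    exact_mod_cast this
  have hQN : 2 * (Q * N) < f := by
    have : (2:ℝ) * (Q * N) < f := by
      rw [← hu8]
      have : (Q:ℝ) * N ≤ (850 * u) * (680 * u ^ 3) := by gcongr
      nlinarith [pow_pos hu0 4, mul_le_mul_of_nonneg_left hu4 (pow_pos hu0 4).le]
    exact_mod_cast this
  obtain ⟨s, hs1, hs2, hs3⟩ := exists_s hk (v := u ^ 4) (by linarith) (by rw [← hu8]; ring)
  have hlN : Real.log N ≤ 6.524 + 0.375 * Real.log f := by
    have h1 := Real.log_le_log (show (0:ℝ) < N by linarith) hN1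
    rw [Real.log_mul (by norm_num) (by positivity), Real.log_pow, hlu] at h1
    have h2 := log_est (a := 680) (by norm_num) 17 160 (by norm_num) (by norm_num)
    norm_num at h1 h2
    norm_num
    linarith
  have hbad : ∀ y : ℕ, N ≤ 4 * y → y ≤ N → (badCount χ y : ℝ) ≤ 0.553 * y := by
    intro y hy1 hy2
    have hy1' : (N:ℝ) ≤ 4 * y := by exact_mod_cast hy1
    have hy2' : (y:ℝ) ≤ N := by exact_mod_cast hy2
    have hby : 1500 * b ≤ y := by
      have : (1500 * b:ℝ) ≤ y := by
        have : (1500 * b:ℝ) ≤ 55500 * u ^ 2 := by linarith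
        nlinarith [mul_le_mul_of_nonneg_right hu1 (pow_pos hu0 2).le]
      exact_mod_cast this
    have h1 := bad_le f χ q₁ q₂ hq₁min hq₂min h293 b y hbq (by omega)
    have h2 := prime_sum b y hb18 hby
    have hy0 : (1:ℝ) < y := by linarith
    have hly := Real.log_pos hy0
    have hly2 : Real.log y ≤ Real.log N := Real.log_le_log (by linarith) hy2'
    have h3 := beta_num (lb := Real.log b) (ly := Real.log y) (by linarith) hly (by linarith)
    have h4 := mul_le_mul_of_nonneg_left h3 (show (0:ℝ) ≤ y by linarith)
    linarith
  have key := burgess hk χ hχ hs1 hs2 (h := 3 * h') (N := N) (Q := Q) hh0 hhf hNf hQf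
    (by rw [hN]; apply le_of_eq; ring) hN6 hQN hbad (m := 0.165) (by norm_num) (by norm_num)
  have hQ31 : Q + 1 ≤ 2 ^ 31 := by
    have : (Q:ℝ) + 1 ≤ 2 ^ 31 := by norm_num; linarith
    exact_mod_cast this
  have hQ22 : 2 ≤ Q := by
    have : (2:ℝ) ≤ Q := by linarith
    exact_mod_cast this
  have hc := primes_count Q hQ22 hQ31
  refine final_ineq (u := u) (h := ((3 * h' : ℕ) : ℝ)) hu1 hu8 ?_ hN2 (c := _) ?_ hs3 key
  · push_cast; linarith
  · refine le_trans ?_ hc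
    linarith

end PartH
end

section
/- Let p be a prime with p ≡ 1 (mod 3) such that 2 and 3 are both cubic residues modulo p (i.e., there exist integers a, b with a³ ≡ 2 (mod p) and b³ ≡ 3 (mod p)). Then there exists a unique pair of integers (x, y) with p = x² + 243·y², x ≡ 3y − 1 (mod 6), and y > 0. -/
open Finset in
lemma aux_dvd_card {α : Type*} [DecidableEq α] (q : ℕ) [Fact q.Prime] (s : Finset α) (σ : α → α)
    (h1 : ∀ x ∈ s, σ x ∈ s) (h2 : ∀ x ∈ s, σ^[q] x = x) (h3 : ∀ x ∈ s, σ x ≠ x) :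
    q ∣ s.card := by
  let f : Function.End s := fun x => ⟨σ x, h1 x x.2⟩
  have hit : ∀ (n : ℕ) (x : s), (((f ^ n) x : s) : α) = σ^[n] x := by
    intro n
    induction n with
    | zero => intro x; rfl
    | succ n ih =>
      intro x
      rw [pow_succ, Function.iterate_succ_apply]
      exact ih (f x)
  have hf : f ^ q ^ 1 = 1 := by
    funext x
    apply Subtype.ext
    rw [hit, pow_one]
    exact h2 x x.2
  have := Equiv.Perm.card_fixedPoints_modEq hf
  have hz : Fintype.card f.fixedPoints = 0 := by
    rw [Fintype.card_eq_zero_iff]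
    refine ⟨fun x => ?_⟩
    have hx : f x.1 = x.1 := x.2
    exact h3 _ x.1.2 (congrArg Subtype.val hx)
  rw [hz, Fintype.card_coe] at this
  exact (Nat.modEq_zero_iff_dvd).1 this

lemma aux_sum_count {α : Type*} (s : Finset α) (g : α → ℂ) (w : ℂ)
    (hw : w ^ 2 + w + 1 = 0)
    (hg : ∀ x ∈ s, g x = 0 ∨ g x = 1 ∨ g x = w ∨ g x = w ^ 2) :
    ∃ n0 : ℕ, ∑ x ∈ s, g x = n0 + (s.filter (fun x => g x = w)).card * w +
        (s.filter (fun x => g x = w ^ 2)).card * w ^ 2 ∧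
      ∑ x ∈ s, (g x) ^ 2 = n0 + (s.filter (fun x => g x = w)).card * w ^ 2 +
        (s.filter (fun x => g x = w ^ 2)).card * w := by
  have hw3 : w ^ 3 = 1 := by linear_combination (w - 1) * hw
  have hw0 : w ≠ 0 := by rintro rfl; simp at hw
  have hw1 : w ≠ 1 := by rintro rfl; norm_num at hw
  have hw2 : w ^ 2 ≠ 1 := by
    intro h; apply hw1; linear_combination hw3 - w * h
  have hw12 : w ^ 2 ≠ w := by
    intro h; apply hw1; apply mul_left_cancel₀ hw0; linear_combination h
  have hw4 : w ^ 4 = w := by linear_combination w * hw3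
  refine ⟨(s.filter (fun x => g x = 1)).card, ?_, ?_⟩
  · simp only [← Finset.sum_boole, Finset.sum_mul, ← Finset.sum_add_distrib]
    refine Finset.sum_congr rfl fun x hx => ?_
    rcases hg x hx with h | h | h | h <;> rw [h] <;>
      simp [hw1, hw2, hw12, hw0.symm, (pow_ne_zero 2 hw0).symm, hw1.symm, hw2.symm, hw12.symm]
  · simp only [← Finset.sum_boole, Finset.sum_mul, ← Finset.sum_add_distrib]
    refine Finset.sum_congr rfl fun x hx => ?_
    rcases hg x hx with h | h | h | h <;> rw [h] <;>
      simp [hw1, hw2, hw12, hw0.symm, (pow_ne_zero 2 hw0).symm, hw1.symm, hw2.symm, hw12.symm, ← pow_mul, hw4]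

lemma aux_indep (w : ℂ) (hw : w ^ 2 + w + 1 = 0) (a b : ℤ) (h : (a : ℂ) + b * w = 0) :
    b = 0 := by
  have h1 : ((a ^ 2 - a * b + b ^ 2 : ℤ) : ℂ) = 0 := by
    push_cast
    linear_combination (a + b * (-1 - w)) * h + b ^ 2 * hw
  have h2 : a ^ 2 - a * b + b ^ 2 = 0 := by exact_mod_cast h1
  have : b ^ 2 = 0 := by nlinarith [sq_nonneg (2 * a - b), sq_nonneg b]
  exact pow_eq_zero_iff (two_ne_zero) |>.1 this

section
variable {F : Type*} [Field F] [Fintype F] [DecidableEq F]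

lemma aux_inner (φ χ : MulChar F ℂ) {u : F} (hu : u ≠ 0) :
    ∑ x, φ x * χ (u - x) = (φ * χ) u * jacobiSum φ χ := by
  rw [jacobiSum, Finset.mul_sum, ← Equiv.sum_comp (Equiv.mulLeft₀ u hu)]
  refine Finset.sum_congr rfl fun x _ => ?_
  have : u - u * x = u * (1 - x) := by ring
  change φ (u * x) * χ (u - u * x) = _
  simp only [this, map_mul, MulChar.mul_apply]
  ring

lemma aux_inner0 (φ χ : MulChar F ℂ) :
    ∑ x, φ x * χ (0 - x) = χ (-1) * ∑ x, (φ * χ) x := by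
  rw [Finset.mul_sum]
  refine Finset.sum_congr rfl fun x _ => ?_
  have : 0 - x = (-1) * x := by ring
  simp only [this, map_mul, MulChar.mul_apply]
  ring

lemma aux_triple (ψ φ χ : MulChar F ℂ) :
    ∑ y, ∑ x, ψ y * φ x * χ (1 - y - x) =
      jacobiSum φ χ * jacobiSum ψ (φ * χ) + χ (-1) * ∑ x, (φ * χ) x := by
  have : ∀ y : F, ∑ x, ψ y * φ x * χ (1 - y - x) =
      jacobiSum φ χ * (ψ y * (φ * χ) (1 - y)) +
        if y = 1 then χ (-1) * ∑ x, (φ * χ) x else 0 := by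
    intro y
    simp only [mul_assoc, ← Finset.mul_sum]
    split_ifs with h
    · subst h
      rw [sub_self, aux_inner0]
      simp [MulChar.map_zero]
    · rw [aux_inner _ _ (sub_ne_zero.2 (Ne.symm h))]
      ring
  simp only [this, Finset.sum_add_distrib, ← Finset.mul_sum]
  simp [jacobiSum]

lemma aux_V (χ : MulChar F ℂ) (h3 : χ ^ 3 = 1) (h1 : χ ≠ 1) (hm : χ (-1) = 1)
    (hJ : jacobiSum χ χ * jacobiSum (χ ^ 2) (χ ^ 2) = Fintype.card F) :
    3 * ∑ z ∈ (Finset.univ : Finset (F × F)).filter (fun z => χ z.1 = 1 ∧ χ z.2 = 1),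
      χ (1 - z.1 - z.2) = Fintype.card F + 1 - jacobiSum χ χ := by
  classical
  have hval : ∀ x : F, (if χ x = 1 then (3 : ℂ) else 0) =
      (1 : MulChar F ℂ) x + χ x + (χ ^ 2) x := by
    intro x
    rw [MulChar.pow_apply' _ two_ne_zero]
    by_cases hx : x = 0
    · simp [hx, MulChar.map_zero]
    · have e : χ x ^ 3 = 1 := by
        rw [← MulChar.pow_apply' _ three_ne_zero, h3, MulChar.one_apply (isUnit_iff_ne_zero.2 hx)]
      rw [MulChar.one_apply (isUnit_iff_ne_zero.2 hx)]
      split_ifs with h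
      · rw [h]; norm_num
      · have : (χ x - 1) * (1 + χ x + χ x ^ 2) = 0 := by linear_combination e
        rcases mul_eq_zero.1 this with h' | h'
        · exact absurd (sub_eq_zero.1 h') h
        · exact h'.symm
  have h2 : χ ^ 2 ≠ 1 := by
    intro h; apply h1
    calc χ = χ ^ 2 * χ := by rw [h, one_mul]
      _ = 1 := by rw [← pow_succ, h3]
  have hinv : χ⁻¹ = χ ^ 2 := by
    rw [inv_eq_iff_mul_eq_one, ← pow_succ', h3]
  have e21 : χ ^ 2 * χ = 1 := by rw [← pow_succ, h3]
  have e11 : χ * χ = χ ^ 2 := (sq χ).symm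
  have J1χ : jacobiSum 1 χ = -1 := jacobiSum_one_nontrivial h1
  have J12 : jacobiSum 1 (χ ^ 2) = -1 := jacobiSum_one_nontrivial h2
  have Jχ1 : jacobiSum χ 1 = -1 := by rw [jacobiSum_comm, J1χ]
  have J21 : jacobiSum (χ ^ 2) 1 = -1 := by rw [jacobiSum_comm, J12]
  have Jχ2 : jacobiSum χ (χ ^ 2) = -1 := by
    rw [← hinv, jacobiSum_nontrivial_inv h1, hm]
  have J2χ : jacobiSum (χ ^ 2) χ = -1 := by rw [jacobiSum_comm, Jχ2]
  have J11 : jacobiSum (1 : MulChar F ℂ) 1 = Fintype.card F - 2 := jacobiSum_one_one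
  have s0 : ∑ x, χ x = 0 := MulChar.sum_eq_zero_of_ne_one h1
  have s2 : ∑ x, (χ ^ 2) x = 0 := MulChar.sum_eq_zero_of_ne_one h2
  have s1 : ∑ x, (1 : MulChar F ℂ) x = Fintype.card F - 1 := by
    rw [MulChar.sum_one_eq_card_units, Fintype.card_units, Nat.cast_sub Fintype.card_pos]
    simp
  have key : 9 * ∑ z ∈ (Finset.univ : Finset (F × F)).filter (fun z => χ z.1 = 1 ∧ χ z.2 = 1),
      χ (1 - z.1 - z.2) = ∑ y, ∑ x, ((1 : MulChar F ℂ) y + χ y + (χ ^ 2) y) *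
        ((1 : MulChar F ℂ) x + χ x + (χ ^ 2) x) * χ (1 - y - x) := by
    rw [Finset.sum_filter, Finset.mul_sum, Fintype.sum_prod_type]
    refine Finset.sum_congr rfl fun y _ => Finset.sum_congr rfl fun x _ => ?_
    rw [← hval, ← hval]
    by_cases hy : χ y = 1 <;> by_cases hx : χ x = 1 <;> simp [hx, hy]
    left; norm_num
  have exp : ∑ y, ∑ x, ((1 : MulChar F ℂ) y + χ y + (χ ^ 2) y) *
        ((1 : MulChar F ℂ) x + χ x + (χ ^ 2) x) * χ (1 - y - x) =
      3 * (Fintype.card F + 1 - jacobiSum χ χ) := by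
    simp only [add_mul, mul_add, Finset.sum_add_distrib, aux_triple, one_mul, e11, e21, J1χ, J12,
      Jχ1, J21, Jχ2, J2χ, J11, s0, s1, s2, hm]
    linear_combination hJ
  have := key.trans exp
  linear_combination this / 3
end

lemma aux_exists (p : ℕ) (hp : p.Prime) (hp3 : p % 3 = 1)
    (h2 : ∃ a : ℤ, a ^ 3 ≡ 2 [ZMOD (p : ℤ)])
    (h3 : ∃ b : ℤ, b ^ 3 ≡ 3 [ZMOD (p : ℤ)]) :
    ∃ x y : ℤ, (p : ℤ) = x ^ 2 + 243 * y ^ 2 := by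
  classical
  haveI : Fact p.Prime := ⟨hp⟩
  have hp2 : p ≠ 2 := by rintro rfl; norm_num at hp3
  obtain ⟨w, hwp⟩ : ∃ w : ℂ, IsPrimitiveRoot w 3 := ⟨_, Complex.isPrimitiveRoot_exp 3 (by norm_num)⟩
  have hw1 : w ≠ 1 := hwp.ne_one (by norm_num)
  have hw3 : w ^ 3 = 1 := hwp.pow_eq_one
  have hw : w ^ 2 + w + 1 = 0 := by
    apply mul_left_cancel₀ (sub_ne_zero.2 hw1)
    linear_combination hw3
  have hw0 : w ≠ 0 := by rintro rfl; simp at hw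
  have hw2 : w ^ 2 ≠ 1 := by
    intro h; apply hw1; linear_combination hw3 - w * h
  have hw20 : w ^ 2 ≠ 0 := pow_ne_zero _ hw0
  obtain ⟨χ, hχ⟩ := MulChar.exists_mulChar_orderOf (ZMod p) (n := 3) (R := ℂ)
    (by rw [ZMod.card]; omega) hwp
  have hχ3 : χ ^ 3 = 1 := by rw [← hχ]; exact pow_orderOf_eq_one χ
  have hχ1 : χ ≠ 1 := by rintro rfl; simp at hχ
  have hχ2 : χ ^ 2 ≠ 1 := by
    intro h; apply hχ1
    calc χ = χ ^ 2 * χ := by rw [h, one_mul]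
      _ = 1 := by rw [← pow_succ, hχ3]
  have hinv : χ⁻¹ = χ ^ 2 := by
    rw [inv_eq_iff_mul_eq_one, ← pow_succ', hχ3]
  have hcube : ∀ x : ZMod p, x ≠ 0 → χ x ^ 3 = 1 := fun x hx => by
    rw [← MulChar.pow_apply' _ three_ne_zero, hχ3, MulChar.one_apply (isUnit_iff_ne_zero.2 hx)]
  have hm : χ (-1) = 1 := by
    have := hcube (-1) (by simp)
    rw [← map_pow] at this
    rwa [show (-1 : ZMod p) ^ 3 = -1 by ring] at this
  have hneg : ∀ x, χ (-x) = χ x := fun x => by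
    rw [← neg_one_mul, map_mul, hm, one_mul]
  have h20 : (2 : ZMod p) ≠ 0 := by
    intro h
    have : ((2 : ℕ) : ZMod p) = 0 := by exact_mod_cast h
    rw [ZMod.natCast_eq_zero_iff] at this
    exact hp2 ((Nat.prime_dvd_prime_iff_eq hp Nat.prime_two).1 this)
  have h30 : (3 : ZMod p) ≠ 0 := by
    intro h
    have : ((3 : ℕ) : ZMod p) = 0 := by exact_mod_cast h
    rw [ZMod.natCast_eq_zero_iff] at this
    have := ((Nat.prime_dvd_prime_iff_eq hp Nat.prime_three).1 this)
    omega
  have c2 : χ 2 = 1 := by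
    obtain ⟨a, ha⟩ := h2
    have := (ZMod.intCast_eq_intCast_iff _ _ _).2 ha
    push_cast at this
    rw [← this, map_pow]
    apply hcube
    intro h; rw [h] at this; exact h20 (by simpa using this.symm)
  have c3 : χ 3 = 1 := by
    obtain ⟨a, ha⟩ := h3
    have := (ZMod.intCast_eq_intCast_iff _ _ _).2 ha
    push_cast at this
    rw [← this, map_pow]
    apply hcube
    intro h; rw [h] at this; exact h30 (by simpa using this.symm)
  have hvals : ∀ x, χ x = 0 ∨ χ x = 1 ∨ χ x = w ∨ χ x = w ^ 2 := by
    intro x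
    by_cases hx : x = 0
    · left; simp [hx, MulChar.map_zero]
    · right
      have : (χ x - 1) * ((χ x - w) * (χ x - w ^ 2)) = 0 := by
        linear_combination hcube x hx + (χ x - (χ x) ^ 2) * hw - (1 - χ x) * hw3
      rcases mul_eq_zero.1 this with h | h
      · exact Or.inl (sub_eq_zero.1 h)
      · rcases mul_eq_zero.1 h with h | h
        · exact Or.inr (Or.inl (sub_eq_zero.1 h))
        · exact Or.inr (Or.inr (sub_eq_zero.1 h))
  have hJJ : jacobiSum χ χ * jacobiSum (χ ^ 2) (χ ^ 2) = Fintype.card (ZMod p) := by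
    rw [← hinv]
    refine jacobiSum_mul_jacobiSum_inv ?_ hχ1 hχ1 (by rwa [← sq])
    rw [ringChar.eq_zero, ZMod.ringChar_zmod_n]
    exact hp.ne_zero.symm
  have hV := aux_V χ hχ3 hχ1 hm hJJ
  obtain ⟨n0, hn1, hn2⟩ := aux_sum_count (Finset.univ : Finset (ZMod p))
    (fun x => χ (x * (1 - x))) w hw (fun x _ => hvals _)
  obtain ⟨m0, hm1, -⟩ := aux_sum_count
    ((Finset.univ : Finset (ZMod p × ZMod p)).filter (fun z => χ z.1 = 1 ∧ χ z.2 = 1))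
    (fun z => χ (1 - z.1 - z.2)) w hw (fun x _ => hvals _)
  have even : ∀ v : ℂ, v ≠ 1 → 
      2 ∣ ((Finset.univ : Finset (ZMod p)).filter (fun x => χ (x * (1 - x)) = v)).card := by
    intro v hv
    refine aux_dvd_card 2 _ (fun x => 1 - x) ?_ ?_ ?_
    · intro x hx
      simp only [Finset.mem_filter, Finset.mem_univ, true_and] at hx ⊢
      rw [← hx]; congr 1; ring
    · intro x _
      simp
    · intro x hx h
      simp only [Finset.mem_filter, Finset.mem_univ, true_and] at hx
      apply hv
      rw [← hx, h, map_mul]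
      have e : χ 2 * χ x = 1 := by
        rw [← map_mul, show (2 : ZMod p) * x = 1 by linear_combination -h, map_one]
      rw [c2, one_mul] at e
      rw [e, one_mul]
  have three : ∀ v : ℂ, v ≠ 1 → v ≠ 0 → 
      3 ∣ (((Finset.univ : Finset (ZMod p × ZMod p)).filter
        (fun z => χ z.1 = 1 ∧ χ z.2 = 1)).filter (fun z => χ (1 - z.1 - z.2) = v)).card := by
    intro v hv hv0
    have nz : ∀ x, χ x = 1 → x ≠ 0 := by rintro x hx rfl; simp [MulChar.map_zero] at hx
    have hi : ∀ x, χ x = 1 → χ x⁻¹ = 1 := by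
      intro x hx
      have : χ x * χ x⁻¹ = 1 := by rw [← map_mul, mul_inv_cancel₀ (nz x hx), map_one]
      rwa [hx, one_mul] at this
    refine aux_dvd_card 3 _ (fun z => (-(z.2 * z.1⁻¹), z.1⁻¹)) ?_ ?_ ?_
    · rintro ⟨x, y⟩ hz
      simp only [Finset.mem_filter, Finset.mem_univ, true_and] at hz ⊢
      obtain ⟨⟨hx, hy⟩, h⟩ := hz
      refine ⟨⟨by rw [hneg, map_mul, hy, hi x hx, one_mul], hi x hx⟩, ?_⟩
      have : 1 - -(y * x⁻¹) - x⁻¹ = -((1 - x - y) * x⁻¹) := by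
        have := nz x hx
        field_simp
        ring
      rw [this, hneg, map_mul, hi x hx, mul_one, h]
    · rintro ⟨x, y⟩ hz
      simp only [Finset.mem_filter, Finset.mem_univ, true_and] at hz
      obtain ⟨⟨hx, hy⟩, h⟩ := hz
      have := nz x hx
      have := nz y hy
      simp only [Function.iterate_succ, Function.iterate_zero, Function.comp, id]
      ext <;> simp <;> field_simp
    · rintro ⟨x, y⟩ hz hfix
      simp only [Finset.mem_filter, Finset.mem_univ, true_and] at hz
      obtain ⟨⟨hx, hy⟩, h⟩ := hz
      have hx0 := nz x hx
      simp only [Prod.mk.injEq] at hfix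
      obtain ⟨e1, e2⟩ := hfix
      have hxy : x * y = 1 := by rw [← e2, mul_inv_cancel₀ hx0]
      have e3 : -y ^ 2 = x := by rw [← e1, e2]; ring
      have e4 : (y + 1) * (1 - x - y) = 0 := by
        linear_combination e3 - hxy
      rcases mul_eq_zero.1 e4 with h' | h'
      · have y1 : y = -1 := by linear_combination h'
        have x1 : x = -1 := by rw [← e3, y1]; ring
        rw [x1, y1, show (1 : ZMod p) - -1 - -1 = 3 by ring, c3] at h
        exact hv h.symm
      · rw [h'] at h
        apply hv0; rw [← h, MulChar.map_zero]
  obtain ⟨k1, hk1⟩ := even w hw1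
  obtain ⟨k2, hk2⟩ := even (w ^ 2) hw2
  obtain ⟨l1, hl1⟩ := three w hw1 hw0
  obtain ⟨l2, hl2⟩ := three (w ^ 2) hw2 hw20
  have hJ : jacobiSum χ χ = n0 + (2 * k1 : ℕ) * w + (2 * k2 : ℕ) * w ^ 2 := by
    rw [← hk1, ← hk2, ← hn1, jacobiSum]
    simp only [map_mul]
  have hJ' : jacobiSum (χ ^ 2) (χ ^ 2) = n0 + (2 * k1 : ℕ) * w ^ 2 + (2 * k2 : ℕ) * w := by
    rw [← hk1, ← hk2, ← hn2, jacobiSum]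
    simp only [map_mul, MulChar.pow_apply' _ two_ne_zero, mul_pow]
  rw [hm1, hl1, hl2, hJ, ZMod.card] at hV
  rw [hJ, hJ', ZMod.card] at hJJ
  push_cast at hV hJJ
  have hb := aux_indep w hw (3 * (m0 - 3 * l2) - p - 1 + (n0 - 2 * k2))
    (9 * (l1 - l2) + 2 * (k1 - k2)) (by
      push_cast
      linear_combination hV - (9 * l2 + 2 * k2) * hw)
  have hpp : (p : ℤ) = (n0 - 2 * k2) ^ 2 - (n0 - 2 * k2) * (2 * (k1 - k2)) + (2 * (k1 - k2)) ^ 2 := by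
    have : (p : ℂ) = (n0 - 2 * k2) ^ 2 - (n0 - 2 * k2) * (2 * (k1 - k2)) + (2 * (k1 - k2)) ^ 2 := by
      rw [← hJJ]
      have e : w ^ 2 = -1 - w := by linear_combination hw
      rw [e]
      linear_combination (-4 * (k1 - k2) ^ 2 : ℂ) * hw
    exact_mod_cast this
  obtain ⟨t, ht⟩ : ∃ t : ℤ, (k1 : ℤ) - k2 = 9 * t := ⟨((k1 : ℤ) - k2) / 9, by omega⟩
  refine ⟨n0 - 2 * k2 - 9 * t, t, ?_⟩
  rw [hpp, ht]; ring

lemma aux_unique {p : ℕ} (hp : p.Prime) {x y u v : ℤ} (h1 : (p : ℤ) = x ^ 2 + 243 * y ^ 2)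
    (h2 : (p : ℤ) = u ^ 2 + 243 * v ^ 2) (hy : 0 < y) (hv : 0 < v) : y = v ∧ x ^ 2 = u ^ 2 := by
  have hp' : Prime (p : ℤ) := Nat.prime_iff_prime_int.1 hp
  have hp0 : (0 : ℤ) < p := by exact_mod_cast hp.pos
  have hd : (p : ℤ) ∣ (x * v - u * y) * (x * v + u * y) := by
    refine ⟨v ^ 2 - y ^ 2, ?_⟩
    linear_combination (-v ^ 2) * h1 + y ^ 2 * h2
  have main : ∀ u : ℤ, (p : ℤ) = u ^ 2 + 243 * v ^ 2 → (p : ℤ) ∣ x * v - u * y →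
      y = v ∧ x ^ 2 = u ^ 2 := by
    rintro u h2 ⟨k, hk⟩
    have id : (p : ℤ) ^ 2 = (x * u + 243 * y * v) ^ 2 + 243 * (x * v - u * y) ^ 2 := by
      calc (p : ℤ) ^ 2 = (x ^ 2 + 243 * y ^ 2) * (u ^ 2 + 243 * v ^ 2) := by
            rw [← h1, ← h2]; ring
        _ = _ := by ring
    rw [hk] at id
    have hk0 : k = 0 := by
      by_contra hne
      have : 1 ≤ k ^ 2 := by
        have := sq_pos_of_ne_zero hne
        omega
      nlinarith [sq_nonneg (x * u + 243 * y * v), sq_pos_of_pos hp0]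
    rw [hk0, mul_zero] at hk
    have e : (p : ℤ) * (v ^ 2 - y ^ 2) = 0 := by
      linear_combination v ^ 2 * h1 - y ^ 2 * h2 + (x * v + u * y) * hk
    have e2 : v ^ 2 - y ^ 2 = 0 := by
      rcases mul_eq_zero.1 e with h | h
      · omega
      · exact h
    have : y = v := by nlinarith
    refine ⟨this, ?_⟩
    subst this
    linear_combination h2 - h1
  rcases hp'.dvd_or_dvd hd with h | h
  · exact main u h2 h
  · have := main (-u) (by rw [h2]; ring) (by simpa [sub_eq_add_neg] using h)
    simpa using this

/-- If `p ≡ 1 (mod 3)` is a prime such that `2` and `3` are cubic residues modulo `p`, then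
`p` can be written uniquely in the form `x² + 243y²` with `x ≡ 3y - 1 (mod 6)` and `y > 0`. -/
theorem unique_representation_x2_243y2 (p : ℕ) (hp : p.Prime) (hp3 : p % 3 = 1)
    (h2 : ∃ a : ℤ, a ^ 3 ≡ 2 [ZMOD (p : ℤ)])
    (h3 : ∃ b : ℤ, b ^ 3 ≡ 3 [ZMOD (p : ℤ)]) :
    ∃! xy : ℤ × ℤ, (p : ℤ) = xy.1 ^ 2 + 243 * xy.2 ^ 2 ∧
      xy.1 ≡ 3 * xy.2 - 1 [ZMOD 6] ∧ 0 < xy.2 := by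
  obtain ⟨x, y, hxy⟩ := aux_exists p hp hp3 h2 h3
  have hodd : p % 2 = 1 := by
    rcases hp.eq_two_or_odd with h | h
    · omega
    · exact h
  have hy : y ≠ 0 := by
    rintro rfl
    have hp' : Prime (p : ℤ) := Nat.prime_iff_prime_int.1 hp
    rw [hxy] at hp'
    simp only [ne_eq, OfNat.ofNat_ne_zero, not_false_eq_true, zero_pow, mul_zero, add_zero] at hp'
    exact not_prime_pow (by norm_num) hp'
  obtain ⟨Y, hY, hxY⟩ : ∃ Y : ℤ, 0 < Y ∧ (p : ℤ) = x ^ 2 + 243 * Y ^ 2 :=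
    ⟨|y|, abs_pos.2 hy, by rw [sq_abs]; exact hxy⟩
  have hpar : (x + Y) % 2 = 1 := by
    have h : (p : ℤ) % 2 = 1 := by omega
    rw [hxY] at h
    rcases Int.emod_two_eq_zero_or_one x with a | a <;>
      rcases Int.emod_two_eq_zero_or_one Y with b | b <;>
      simp [pow_two, Int.add_emod, Int.mul_emod, a, b] at h ⊢
  have hx3 : x % 3 ≠ 0 := by
    intro a
    have h : (p : ℤ) % 3 = 1 := by omega
    rw [hxY] at h
    simp [pow_two, Int.add_emod, Int.mul_emod, a] at h
  obtain ⟨X, hX, hXp⟩ : ∃ X : ℤ, X ≡ 3 * Y - 1 [ZMOD 6] ∧ (p : ℤ) = X ^ 2 + 243 * Y ^ 2 := by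
    by_cases h : x % 3 = 2
    · exact ⟨x, by unfold Int.ModEq; omega, hxY⟩
    · exact ⟨-x, by unfold Int.ModEq; omega, by rw [hxY]; ring⟩
  refine ⟨(X, Y), ⟨hXp, hX, hY⟩, ?_⟩
  rintro ⟨u, v⟩ ⟨a, b, c⟩
  simp only at a b c
  obtain ⟨e1, e2⟩ := aux_unique hp a hXp c hY
  subst e1
  rcases sq_eq_sq_iff_eq_or_eq_neg.1 e2 with h | h
  · rw [h]
  · exfalso
    unfold Int.ModEq at hX b
    omega
end
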